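/- Assume p = 2. Every homomorphism of algebraic groups σ : SL(2,k) → SL(4,k) is equivalent to exactly one homomorphism in the following list; in particular, any two distinct members of the list (belonging to different items, or to the same item with different parameter values) are inequivalent. Writing A = [[a,b],[c,d]] ∈ SL(2,k) and q = 2^e: (IV) for each pair of integers e₂ > e₁ ≥ 0, the map A ↦ A^{(2^{e₂})} ⊗ A^{(2^{e₁})}; (V) for each integer e ≥ 0, the map A ↦ [[1, 0, 0, 0], [a^{q}b^{q}, a^{2q}, b^{2q}, 0], [c^{q}d^{q}, c^{2q}, d^{2q}, 0], [b^{q}c^{q}, a^{q}c^{q}, b^{q}d^{q}, 1]]; (XI) for each integer e ≥ 0, the map A ↦ [[a^{2q}, b^{2q}, a^{q}b^{q}, 0], [c^{2q}, d^{2q}, c^{q}d^{q}, 0], [0, 0, 1, 0], [0, 0, 0, 1]]; (XV) for each pair of integers e₂ ≥ e₃ ≥ 0, the block-diagonal map A ↦ diag(A^{(2^{e₂})}, A^{(2^{e₃})}); (XIX) for each integer e ≥ 0, the map A ↦ [[a^{2q}, b^{2q}, 0, 0], [c^{2q}, d^{2q}, 0, 0], [a^{q}c^{q}, b^{q}d^{q},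 1, 0], [0, 0, 0, 1]]; (XXIV) for each integer e ≥ 0, the block-diagonal map A ↦ diag(A^{(2^{e})}, 1, 1); (XXVI) the constant map A ↦ I₄. -/

import Mathlib

open Matrix

/-- Entrywise `m`-th power of a 2×2 matrix: `A^{(m)} = [[a^m, b^m],[c^m, d^m]]`. -/
noncomputable def entryPow {k : Type*} [Field k] (A : Matrix (Fin 2) (Fin 2) k) (m : ℕ) :
    Matrix (Fin 2) (Fin 2) k :=
  Matrix.of fun i j => A i j ^ m

/-- The Kronecker product of two 2×2 matrices as a 4×4 matrix in 2×2 blocks. -/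
noncomputable def kron4 {k : Type*} [Field k] (X Y : Matrix (Fin 2) (Fin 2) k) :
    Matrix (Fin 4) (Fin 4) k :=
  !![X 0 0 * Y 0 0, X 0 0 * Y 0 1, X 0 1 * Y 0 0, X 0 1 * Y 0 1;
     X 0 0 * Y 1 0, X 0 0 * Y 1 1, X 0 1 * Y 1 0, X 0 1 * Y 1 1;
     X 1 0 * Y 0 0, X 1 0 * Y 0 1, X 1 1 * Y 0 0, X 1 1 * Y 0 1;
     X 1 0 * Y 1 0, X 1 0 * Y 1 1, X 1 1 * Y 1 0, X 1 1 * Y 1 1]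

/-- The block-diagonal 4×4 matrix `diag(X, Y)` built from two 2×2 matrices. -/
noncomputable def blockDiag4 {k : Type*} [Field k] (X Y : Matrix (Fin 2) (Fin 2) k) :
    Matrix (Fin 4) (Fin 4) k :=
  !![X 0 0, X 0 1, 0, 0;
     X 1 0, X 1 1, 0, 0;
     0, 0, Y 0 0, Y 0 1;
     0, 0, Y 1 0, Y 1 1]

/-- Family (V) (for `p = 2`). -/
noncomputable def famV (k : Type*) [Field k] (q : ℕ)
    (A : SpecialLinearGroup (Fin 2) k) : Matrix (Fin 4) (Fin 4) k :=
  let a := A.1 0 0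
  let b := A.1 0 1
  let c := A.1 1 0
  let d := A.1 1 1
  !![1, 0, 0, 0;
     a ^ q * b ^ q, a ^ (2 * q), b ^ (2 * q), 0;
     c ^ q * d ^ q, c ^ (2 * q), d ^ (2 * q), 0;
     b ^ q * c ^ q, a ^ q * c ^ q, b ^ q * d ^ q, 1]

/-- Family (XI) (for `p = 2`). -/
noncomputable def famXI (k : Type*) [Field k] (q : ℕ)
    (A : SpecialLinearGroup (Fin 2) k) : Matrix (Fin 4) (Fin 4) k :=
  let a := A.1 0 0
  let b := A.1 0 1
  let c := A.1 1 0
  let d := A.1 1 1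
  !![a ^ (2 * q), b ^ (2 * q), a ^ q * b ^ q, 0;
     c ^ (2 * q), d ^ (2 * q), c ^ q * d ^ q, 0;
     0, 0, 1, 0;
     0, 0, 0, 1]

/-- Family (XIX) (for `p = 2`). -/
noncomputable def famXIX (k : Type*) [Field k] (q : ℕ)
    (A : SpecialLinearGroup (Fin 2) k) : Matrix (Fin 4) (Fin 4) k :=
  let a := A.1 0 0
  let b := A.1 0 1
  let c := A.1 1 0
  let d := A.1 1 1
  !![a ^ (2 * q), b ^ (2 * q), 0, 0;
     c ^ (2 * q), d ^ (2 * q), 0, 0;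
     a ^ q * c ^ q, b ^ q * d ^ q, 1, 0;
     0, 0, 0, 1]

/-- Entrywise polynomial condition: each matrix entry of `σ(A)` is a fixed polynomial
in the four entries of `A`. -/
def IsPolyEntries {k : Type*} [Field k]
    (σ : SpecialLinearGroup (Fin 2) k → Matrix (Fin 4) (Fin 4) k) : Prop :=
  ∀ i j : Fin 4, ∃ P : MvPolynomial (Fin 2 × Fin 2) k,
    ∀ A : SpecialLinearGroup (Fin 2) k,
      σ A i j = MvPolynomial.eval (fun x => A.1 x.1 x.2) P

/-- Equivalence of matrix-valued maps on `SL(2,k)`: conjugacy by some `P ∈ GL(4,k)`. -/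
def MatEquiv {k : Type*} [Field k]
    (f g : SpecialLinearGroup (Fin 2) k → Matrix (Fin 4) (Fin 4) k) : Prop :=
  ∃ P : GL (Fin 4) k, ∀ A : SpecialLinearGroup (Fin 2) k,
    ((P⁻¹ : GL (Fin 4) k) : Matrix (Fin 4) (Fin 4) k) * f A *
      (P : Matrix (Fin 4) (Fin 4) k) = g A

/-- The index set of the classification list for `p = 2`. -/
inductive Idx15 : Type
  | IV : (e₁ e₂ : ℕ) → e₁ < e₂ → Idx15
  | V : ℕ → Idx15
  | XI : ℕ → Idx15
  | XV : (e₂ e₃ : ℕ) → e₃ ≤ e₂ → Idx15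
  | XIX : ℕ → Idx15
  | XXIV : ℕ → Idx15
  | XXVI : Idx15

/-- The classification list of homomorphisms `SL(2,k) → SL(4,k)` for `p = 2`. -/
noncomputable def list15 {k : Type*} [Field k] (p : ℕ) :
    Idx15 → SpecialLinearGroup (Fin 2) k → Matrix (Fin 4) (Fin 4) k
  | Idx15.IV e₁ e₂ _ => fun A => kron4 (entryPow A.1 (p ^ e₂)) (entryPow A.1 (p ^ e₁))
  | Idx15.V e => famV k (p ^ e)
  | Idx15.XI e => famXI k (p ^ e)
  | Idx15.XV e₂ e₃ _ => fun A => blockDiag4 (entryPow A.1 (p ^ e₂)) (entryPow A.1 (p ^ e₃))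
  | Idx15.XIX e => famXIX k (p ^ e)
  | Idx15.XXIV e => fun A => blockDiag4 (entryPow A.1 (p ^ e)) 1
  | Idx15.XXVI => fun _ => 1

namespace SL2CharTwo

local notation "SL₂" k => SpecialLinearGroup (Fin 2) k
local notation "M₄" k => Matrix (Fin 4) (Fin 4) k

section Elements

variable {k : Type*} [Field k]

/-- The upper unipotent element with off-diagonal entry `x`. -/
def upper (x : k) : SL₂ k := ⟨!![1, x; 0, 1], by simp⟩

/-- The lower unipotent element with off-diagonal entry `y`. -/
def lower (y : k) : SL₂ k := ⟨!![1, 0; y, 1], by simp⟩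

/-- The diagonal element `diag(t, t⁻¹)`. -/
def torus (t : kˣ) : SL₂ k := ⟨!![(t : k), 0; 0, ((t⁻¹ : kˣ) : k)], by simp⟩

/-- The standard representative of the nontrivial Weyl group element. -/
def weyl : SL₂ k := ⟨!![0, 1; -1, 0], by simp⟩

lemma coe_upper (x : k) : (upper x : Matrix (Fin 2) (Fin 2) k) = !![1, x; 0, 1] := rfl

lemma coe_lower (y : k) : (lower y : Matrix (Fin 2) (Fin 2) k) = !![1, 0; y, 1] := rfl

lemma coe_torus (t : kˣ) :
    (torus t : Matrix (Fin 2) (Fin 2) k) = !![(t : k), 0; 0, ((t⁻¹ : kˣ) : k)] := rfl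

lemma coe_weyl : (weyl : SL₂ k).1 = !![0, 1; -1, 0] := rfl

lemma upper_add (x y : k) : upper (x + y) = upper x * upper y := by
  ext i j
  fin_cases i <;> fin_cases j <;> simp [coe_upper, Matrix.mul_apply, Fin.sum_univ_two, add_comm]

lemma lower_add (x y : k) : lower (x + y) = lower x * lower y := by
  ext i j
  fin_cases i <;> fin_cases j <;> simp [coe_lower, Matrix.mul_apply, Fin.sum_univ_two]

lemma upper_zero : upper (0 : k) = 1 := by
  ext i j
  fin_cases i <;> fin_cases j <;> simp [coe_upper]

lemma lower_zero : lower (0 : k) = 1 := by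
  ext i j
  fin_cases i <;> fin_cases j <;> simp [coe_lower]

lemma torus_one : torus (1 : kˣ) = 1 := by
  ext i j
  fin_cases i <;> fin_cases j <;> simp [coe_torus]

lemma torus_mul (s t : kˣ) : torus (s * t) = torus s * torus t := by
  ext i j
  fin_cases i <;> fin_cases j <;> simp [coe_torus, Matrix.mul_apply, Fin.sum_univ_two, mul_comm]

lemma torus_mul_upper (t : kˣ) (x : k) :
    torus t * upper x = upper ((t : k) ^ 2 * x) * torus t := by
  ext i j
  fin_cases i <;> fin_cases j <;> simp [coe_torus, coe_upper, Matrix.mul_apply, Fin.sum_univ_two]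
  field_simp

lemma lower_mul_torus (t : kˣ) (y : k) :
    lower y * torus t = torus t * lower ((t : k) ^ 2 * y) := by
  ext i j
  fin_cases i <;> fin_cases j <;> simp [coe_torus, coe_lower, Matrix.mul_apply, Fin.sum_univ_two]
  field_simp

lemma torus_mul_weyl (t : kˣ) : torus t * weyl = weyl * torus t⁻¹ := by
  ext i j
  fin_cases i <;> fin_cases j <;> simp [coe_torus, coe_weyl, Matrix.mul_apply, Fin.sum_univ_two]

lemma upper_mul_lower (z : k) (s : kˣ) (hs : (s : k) = 1 + z) :
    upper 1 * lower z = lower (z / s) * torus s * upper (1 / (s : k)) := by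
  have h0 : (s : k) ≠ 0 := s.ne_zero
  have hz : z = s - 1 := by rw [hs]; ring
  subst hz
  ext i j
  fin_cases i <;> fin_cases j <;>
    simp [coe_torus, coe_lower, coe_upper, Matrix.mul_apply, Fin.sum_univ_two] <;> field_simp
  ring

/-- The unipotent elements generate `SL(2,k)`. -/
lemma hom_ext {M : Type*} [Monoid M] {f g : (SL₂ k) →* M}
    (hu : ∀ x, f (upper x) = g (upper x)) (hl : ∀ y, f (lower y) = g (lower y)) : f = g := by
  have key : ∀ A : SL₂ k, A.1 1 0 ≠ 0 → f A = g A := by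
    intro A hc
    have hdet := A.2
    rw [Matrix.det_fin_two] at hdet
    have hA : A = upper ((A.1 0 0 - 1) / A.1 1 0) * lower (A.1 1 0) *
        upper ((A.1 1 1 - 1) / A.1 1 0) := by
      ext i j
      fin_cases i <;> fin_cases j <;>
        simp [coe_lower, coe_upper, Matrix.mul_apply, Fin.sum_univ_two] <;> field_simp
      · ring
      · linear_combination -hdet
      · ring
    rw [hA]
    simp only [map_mul, hu, hl]
  ext A
  by_cases hc : A.1 1 0 = 0
  · have hdet := A.2
    rw [Matrix.det_fin_two, hc] at hdet
    have ha : A.1 0 0 ≠ 0 := by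
      rintro h
      simp [h] at hdet
    have hA : A = lower (-1) * (lower 1 * A) := by
      rw [← mul_assoc, ← lower_add]
      simp [lower_zero]
    rw [hA, map_mul f, map_mul g, hl, key (lower 1 * A)]
    simpa [coe_lower, Matrix.mul_apply, Fin.sum_univ_two, hc] using ha
  · exact key A hc

end Elements

section Families

variable {k : Type*} [Field k]

lemma entryPow_mul [CharP k 2] (A B : Matrix (Fin 2) (Fin 2) k) (e : ℕ) :
    entryPow (A * B) (2 ^ e) = entryPow A (2 ^ e) * entryPow B (2 ^ e) := by
  ext i j
  simp [entryPow, Matrix.mul_apply, Fin.sum_univ_two, add_pow_char_pow, mul_pow]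

lemma entryPow_one (m : ℕ) (hm : m ≠ 0) : entryPow (1 : Matrix (Fin 2) (Fin 2) k) m = 1 := by
  ext i j
  fin_cases i <;> fin_cases j <;> simp [entryPow, hm]

lemma kron4_mul (X X' Y Y' : Matrix (Fin 2) (Fin 2) k) :
    kron4 (X * X') (Y * Y') = kron4 X Y * kron4 X' Y' := by
  ext i j
  fin_cases i <;> fin_cases j <;>
    simp [kron4, Matrix.mul_apply, Fin.sum_univ_two, Fin.sum_univ_four] <;> ring

lemma blockDiag4_mul (X X' Y Y' : Matrix (Fin 2) (Fin 2) k) :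
    blockDiag4 (X * X') (Y * Y') = blockDiag4 X Y * blockDiag4 X' Y' := by
  ext i j
  fin_cases i <;> fin_cases j <;>
    simp [blockDiag4, Matrix.mul_apply, Fin.sum_univ_two, Fin.sum_univ_four]

lemma kron4_one : kron4 (1 : Matrix (Fin 2) (Fin 2) k) 1 = 1 := by
  ext i j
  fin_cases i <;> fin_cases j <;> simp [kron4]

lemma blockDiag4_one : blockDiag4 (1 : Matrix (Fin 2) (Fin 2) k) 1 = 1 := by
  ext i j
  fin_cases i <;> fin_cases j <;> simp [blockDiag4]

lemma det_pow [CharP k 2] (A : SL₂ k) (e : ℕ) :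
    A.1 0 0 ^ 2 ^ e * A.1 1 1 ^ 2 ^ e + A.1 0 1 ^ 2 ^ e * A.1 1 0 ^ 2 ^ e = 1 := by
  have h := A.2
  rw [Matrix.det_fin_two, CharTwo.sub_eq_add] at h
  rw [← mul_pow, ← mul_pow, ← add_pow_char_pow, h, one_pow]

lemma famV_mul [CharP k 2] (e : ℕ) (A B : SL₂ k) :
    famV k (2 ^ e) (A * B) = famV k (2 ^ e) A * famV k (2 ^ e) B := by
  have hA := det_pow A e
  have hB := det_pow B e
  have h2 : (2 : k) = 0 := CharTwo.two_eq_zero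
  ext i j
  fin_cases i <;> fin_cases j <;>
    simp [famV, Matrix.mul_apply, Fin.sum_univ_two, Fin.sum_univ_four, add_pow_char_pow, mul_pow,
      pow_mul'] <;> grind

lemma famXI_mul [CharP k 2] (e : ℕ) (A B : SL₂ k) :
    famXI k (2 ^ e) (A * B) = famXI k (2 ^ e) A * famXI k (2 ^ e) B := by
  have hA := det_pow A e
  have hB := det_pow B e
  have h2 : (2 : k) = 0 := CharTwo.two_eq_zero
  ext i j
  fin_cases i <;> fin_cases j <;>
    simp [famXI, Matrix.mul_apply, Fin.sum_univ_two, Fin.sum_univ_four, add_pow_char_pow, mul_pow,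
      pow_mul'] <;> grind

lemma famXIX_mul [CharP k 2] (e : ℕ) (A B : SL₂ k) :
    famXIX k (2 ^ e) (A * B) = famXIX k (2 ^ e) A * famXIX k (2 ^ e) B := by
  have hA := det_pow A e
  have hB := det_pow B e
  have h2 : (2 : k) = 0 := CharTwo.two_eq_zero
  ext i j
  fin_cases i <;> fin_cases j <;>
    simp [famXIX, Matrix.mul_apply, Fin.sum_univ_two, Fin.sum_univ_four, add_pow_char_pow, mul_pow,
      pow_mul'] <;> grind

lemma famV_one (q : ℕ) (hq : q ≠ 0) : famV k q 1 = 1 := by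
  ext i j
  fin_cases i <;> fin_cases j <;> simp [famV, hq]

lemma famXI_one (q : ℕ) (hq : q ≠ 0) : famXI k q 1 = 1 := by
  ext i j
  fin_cases i <;> fin_cases j <;> simp [famXI, hq]

lemma famXIX_one (q : ℕ) (hq : q ≠ 0) : famXIX k q 1 = 1 := by
  ext i j
  fin_cases i <;> fin_cases j <;> simp [famXIX, hq]

/-- The members of the list as monoid homomorphisms into `4×4` matrices. -/
noncomputable def listHom [CharP k 2] (i : Idx15) : (SL₂ k) →* M₄ k where
  toFun := list15 2 i
  map_one' := by
    cases i <;> simp [list15, entryPow_one, kron4_one, blockDiag4_one, famV_one, famXI_one,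
      famXIX_one]
  map_mul' A B := by
    cases i with
    | IV e₁ e₂ h => simp [list15, entryPow_mul, kron4_mul]
    | V e => exact famV_mul e A B
    | XI e => exact famXI_mul e A B
    | XV e₂ e₃ h => simp [list15, entryPow_mul, blockDiag4_mul]
    | XIX e => exact famXIX_mul e A B
    | XXIV e => simp [list15, entryPow_mul, ← blockDiag4_mul]
    | XXVI => simp [list15]

/-- Conjugation of a matrix representation by an invertible matrix. -/
noncomputable def conjHom (f : (SL₂ k) →* M₄ k) (Q : GL (Fin 4) k) : (SL₂ k) →* M₄ k where
  toFun A := ((Q⁻¹ : GL (Fin 4) k) : M₄ k) * f A * (Q : M₄ k)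
  map_one' := by simp
  map_mul' A B := by simp only [map_mul, mul_assoc, Units.mul_inv_cancel_left]

/-- Intertwining on the unipotent generators suffices for equivalence. -/
lemma matEquiv_of_generators (f g : (SL₂ k) →* M₄ k) (P : M₄ k) (hP : P.det ≠ 0)
    (hu : ∀ x, f (upper x) * P = P * g (upper x))
    (hl : ∀ y, f (lower y) * P = P * g (lower y)) : MatEquiv f g := by
  let Q : GL (Fin 4) k := Matrix.GeneralLinearGroup.mkOfDetNeZero P hP
  have hQ : (Q : M₄ k) = P := rfl
  have hfg : conjHom f Q = g := by
    apply hom_ext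
    · intro x
      change ((Q⁻¹ : GL (Fin 4) k) : M₄ k) * f (upper x) * (Q : M₄ k) = _
      rw [mul_assoc, hQ, hu, ← hQ, Units.inv_mul_cancel_left]
    · intro x
      change ((Q⁻¹ : GL (Fin 4) k) : M₄ k) * f (lower x) * (Q : M₄ k) = _
      rw [mul_assoc, hQ, hl, ← hQ, Units.inv_mul_cancel_left]
  exact ⟨Q, fun A => DFunLike.congr_fun hfg A⟩

lemma MatEquiv.symm {f g : (SL₂ k) → M₄ k} (h : MatEquiv f g) : MatEquiv g f := by
  obtain ⟨P, hP⟩ := h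
  refine ⟨P⁻¹, fun A => ?_⟩
  rw [← hP A, inv_inv]
  simp only [mul_assoc, Units.mul_inv_cancel_left, Units.mul_inv, mul_one]

lemma MatEquiv.trans {f g h : (SL₂ k) → M₄ k} (hfg : MatEquiv f g) (hgh : MatEquiv g h) :
    MatEquiv f h := by
  obtain ⟨P, hP⟩ := hfg
  obtain ⟨Q, hQ⟩ := hgh
  refine ⟨P * Q, fun A => ?_⟩
  rw [← hQ A, ← hP A]
  simp only [_root_.mul_inv_rev, Units.val_mul, mul_assoc]

end Families

section Weights

variable {k : Type*} [Field k]

lemma exists_zpow_ne_one [Infinite k] {n : ℤ} (hn : n ≠ 0) : ∃ t : kˣ, t ^ n ≠ 1 := by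
  by_contra! h
  have hN : n.natAbs ≠ 0 := by simpa using hn
  have h1 : ∀ t : kˣ, (t : k) ^ n.natAbs = 1 := by
    intro t
    have h2 : t ^ n.natAbs = 1 := by
      rcases Int.natAbs_eq n with h3 | h3
      · have := h t
        rw [h3, zpow_natCast] at this
        exact this
      · have := h t
        rw [h3, _root_.zpow_neg, zpow_natCast, inv_eq_one] at this
        exact this
    rw [← Units.val_pow_eq_pow_val, h2, Units.val_one]
  have h2 : (Polynomial.X * (Polynomial.X ^ n.natAbs - 1) : Polynomial k) = 0 := by
    apply Polynomial.funext
    intro x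
    by_cases hx : x = 0
    · simp [hx]
    · have := h1 (Units.mk0 x hx)
      simp_all
  rcases mul_eq_zero.mp h2 with h3 | h3
  · exact Polynomial.X_ne_zero h3
  · exact Polynomial.X_pow_sub_C_ne_zero (Nat.pos_of_ne_zero hN) (1 : k) (by simpa using h3)

/-- The character `t ↦ tⁿ` of the torus. -/
def character (k : Type*) [Field k] (n : ℤ) : kˣ →* k :=
  (Units.coeHom k).comp (zpowGroupHom n)

lemma character_apply (n : ℤ) (t : kˣ) : character k n t = ((t ^ n : kˣ) : k) := rfl

lemma character_injective [Infinite k] : Function.Injective (character k) := by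
  intro m n h
  by_contra hne
  obtain ⟨t, ht⟩ := exists_zpow_ne_one (k := k) (sub_ne_zero.mpr hne)
  have h1 := DFunLike.congr_fun h t
  rw [character_apply, character_apply, Units.val_inj] at h1
  rw [_root_.zpow_sub, h1, mul_inv_cancel] at ht
  exact ht rfl

lemma linearIndependent_character [Infinite k] :
    LinearIndependent k (fun n : ℤ => (character k n : kˣ → k)) :=
  (linearIndependent_monoidHom kˣ k).comp _ character_injective

lemma eval_torus_mem_span (P : MvPolynomial (Fin 2 × Fin 2) k) :
    (fun t : kˣ => MvPolynomial.eval (fun x => (torus t).1 x.1 x.2) P) ∈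
      Submodule.span k (Set.range fun n : ℤ => (character k n : kˣ → k)) := by
  set S := Submodule.span k (Set.range fun n : ℤ => (character k n : kˣ → k)) with hS
  have hmul : ∀ (n : ℤ) (f : kˣ → k), f ∈ S → f * (character k n : kˣ → k) ∈ S := by
    intro n f hf
    induction hf using Submodule.span_induction with
    | mem x hx =>
      obtain ⟨m, rfl⟩ := hx
      apply Submodule.subset_span
      refine ⟨m + n, ?_⟩
      ext t
      simp [character_apply, _root_.zpow_add]
    | zero => simp
    | add x y _ _ hx hy => rw [add_mul]; exact S.add_mem hx hy
    | smul a x _ hx => rw [smul_mul_assoc]; exact S.smul_mem a hx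
  induction P using MvPolynomial.induction_on with
  | C a =>
    have : (fun t : kˣ => MvPolynomial.eval (fun x : Fin 2 × Fin 2 => (torus t).1 x.1 x.2)
        (MvPolynomial.C a)) = a • (character k 0 : kˣ → k) := by
      ext t
      simp [character_apply]
    rw [this]
    exact S.smul_mem a (Submodule.subset_span ⟨0, rfl⟩)
  | add p q hp hq =>
    simp only [map_add]
    exact S.add_mem hp hq
  | mul_X p ij hp =>
    obtain ⟨i, j⟩ := ij
    simp only [map_mul, MvPolynomial.eval_X]
    have h1 := hmul 1 _ hp
    have h2 := hmul (-1) _ hp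
    fin_cases i <;> fin_cases j
    · convert h1 using 1
      ext t
      simp [character_apply, coe_torus]
    · convert S.zero_mem using 1
      ext t
      simp [coe_torus]
    · convert S.zero_mem using 1
      ext t
      simp [coe_torus]
    · convert h2 using 1
      ext t
      simp [character_apply, coe_torus]

/-- The torus acts diagonalizably, with integral weights in decreasing order. -/
lemma exists_weight_basis [Infinite k] (ρ : (SL₂ k) →* M₄ k) (hρ : IsPolyEntries ρ) :
    ∃ (P : GL (Fin 4) k) (w : Fin 4 → ℤ), Antitone w ∧
      ∀ t, ρ (torus t) * (P : M₄ k) =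
        (P : M₄ k) * Matrix.diagonal fun i => ((t ^ w i : kˣ) : k) := by
  have hc : ∀ i j, ∃ c : ℤ →₀ k, ∀ t, ρ (torus t) i j =
      c.sum fun n a => a * ((t ^ n : kˣ) : k) := by
    intro i j
    obtain ⟨P, hP⟩ := hρ i j
    obtain ⟨c, hc⟩ := Finsupp.mem_span_range_iff_exists_finsupp.mp (eval_torus_mem_span P)
    refine ⟨c, fun t => ?_⟩
    rw [hP, ← congrFun hc t, Finsupp.sum, Finset.sum_apply]
    rfl
  choose c hc using hc
  let S : Finset ℤ := Finset.univ.biUnion fun i => Finset.univ.biUnion fun j => (c i j).support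
  have hsub : ∀ i j, (c i j).support ⊆ S := fun i j n hn =>
    Finset.mem_biUnion.mpr ⟨i, Finset.mem_univ _,
      Finset.mem_biUnion.mpr ⟨j, Finset.mem_univ _, hn⟩⟩
  have hS : ∀ i j t, ρ (torus t) i j = ∑ n ∈ S, c i j n * ((t ^ n : kˣ) : k) := by
    intro i j t
    rw [hc, Finsupp.sum_of_support_subset _ (hsub i j)]
    simp
  let E : ℤ → M₄ k := fun n => Matrix.of fun i j => c i j n
  have hE1 : ∑ n ∈ S, E n = 1 := by
    have h1 : ρ (torus 1) = 1 := by rw [torus_one, map_one]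
    rw [← h1]
    ext i j
    rw [hS, Matrix.sum_apply]
    simp [E]
  have hE : ∀ t, ∀ n ∈ S, ρ (torus t) * E n = ((t ^ n : kˣ) : k) • E n := by
    intro t n hn
    ext i j
    have h1 := linearIndependent_iff'.mp (linearIndependent_character (k := k)) S
      (fun n => (ρ (torus t) * E n) i j - ((t ^ n : kˣ) : k) * E n i j) (by
        ext s
        have h2 : ρ (torus (t * s)) i j = (ρ (torus t) * ρ (torus s)) i j := by
          rw [torus_mul, map_mul]
        rw [hS, Matrix.mul_apply] at h2
        simp only [hS _ _ s] at h2
        simp only [Finset.sum_apply, Pi.smul_apply, smul_eq_mul, sub_mul, Finset.sum_sub_distrib,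
          Pi.zero_apply, character_apply]
        rw [sub_eq_zero]
        trans ∑ n ∈ S, c i j n * (((t * s) ^ n : kˣ) : k)
        · rw [h2]
          simp only [Finset.mul_sum, Matrix.mul_apply, Finset.sum_mul]
          rw [Finset.sum_comm]
          simp only [E, Matrix.of_apply, mul_assoc]
        · refine Finset.sum_congr rfl fun n _ => ?_
          simp only [E, Matrix.of_apply, mul_zpow, Units.val_mul]
          ring) n hn
    simpa [sub_eq_zero] using h1
  let W : Set (Fin 4 → k) := {v | ∃ n : ℤ, ∀ t, ρ (torus t) *ᵥ v = ((t ^ n : kˣ) : k) • v}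
  have hW : ⊤ ≤ Submodule.span k W := by
    intro v _
    have h1 : v = ∑ n ∈ S, E n *ᵥ v := by
      rw [← Matrix.sum_mulVec, hE1, Matrix.one_mulVec]
    rw [h1]
    refine Submodule.sum_mem _ fun n hn => Submodule.subset_span ⟨n, fun t => ?_⟩
    rw [Matrix.mulVec_mulVec, hE t n hn, Matrix.smul_mulVec]
  let b₀ := Module.Basis.ofSpan hW
  have hb₀ : ∀ i, b₀ i ∈ W := fun i => Module.Basis.ofSpan_subset hW ⟨i, rfl⟩
  have : Fintype ((linearIndepOn_empty k (id : (Fin 4 → k) → _)).extend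
      (Set.empty_subset W)) := FiniteDimensional.fintypeBasisIndex b₀
  have hcard : Fintype.card ((linearIndepOn_empty k (id : (Fin 4 → k) → _)).extend
      (Set.empty_subset W)) = 4 := by
    rw [← Module.finrank_eq_card_basis b₀]; simp
  let b₁ := b₀.reindex (Fintype.equivFinOfCardEq hcard)
  have hb₁ : ∀ i, b₁ i ∈ W := fun i => by
    rw [Module.Basis.reindex_apply]; exact hb₀ _
  choose w₁ hw₁ using hb₁
  let π := Tuple.sort (fun i => -w₁ i)
  have hπ : Monotone ((fun i => -w₁ i) ∘ π) := Tuple.monotone_sort _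
  let b := b₁.reindex π.symm
  have hb : ∀ i, b i = b₁ (π i) := fun i => by simp [b]
  let Q : M₄ k := (Pi.basisFun k (Fin 4)).toMatrix b
  have hQ : ∀ i j, Q i j = b j i := fun i j => by simp [Q, Module.Basis.toMatrix_apply]
  have hQu : IsUnit Q := by
    have := (Pi.basisFun k (Fin 4)).invertibleToMatrix b
    exact isUnit_of_invertible Q
  refine ⟨hQu.unit, w₁ ∘ π, fun i j hij => by simpa using hπ hij, fun t => ?_⟩
  rw [IsUnit.unit_spec]
  ext i j
  rw [Matrix.mul_diagonal, Matrix.mul_apply]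
  have h1 := congrFun (hw₁ (π j) t) i
  simp only [hQ, hb]
  rw [mul_comm]
  simpa [Matrix.mulVec, dotProduct] using h1

/-- Two diagonal actions of the torus intertwined by an invertible matrix have the same weights. -/
lemma exists_perm_weights [Infinite k] {w w' : Fin 4 → ℤ} {P : M₄ k} (hP : P.det ≠ 0)
    (h : ∀ t : kˣ, (Matrix.diagonal fun i => ((t ^ w i : kˣ) : k)) * P =
      P * Matrix.diagonal fun i => ((t ^ w' i : kˣ) : k)) :
    ∃ π : Equiv.Perm (Fin 4), ∀ i, w (π i) = w' i := by
  rw [Matrix.det_apply] at hP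
  obtain ⟨π, -, hπ⟩ := Finset.exists_ne_zero_of_sum_ne_zero hP
  refine ⟨π, fun i => ?_⟩
  have hne : P (π i) i ≠ 0 := by
    intro h0
    apply hπ
    have h1 : ∏ j, P (π j) j = 0 := Finset.prod_eq_zero (Finset.mem_univ i) h0
    rw [h1, smul_zero]
  by_contra hw
  apply hw
  apply character_injective (k := k)
  ext t
  have h1 := congrFun (congrFun (h t) (π i)) i
  rw [Matrix.diagonal_mul, Matrix.mul_diagonal, mul_comm] at h1
  exact mul_left_cancel₀ hne h1

/-- The weights of the torus are symmetric about zero. -/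
lemma weights_symm [Infinite k] (ρ : (SL₂ k) →* M₄ k) {w : Fin 4 → ℤ} (hw : Antitone w)
    (h : ∀ t, ρ (torus t) = Matrix.diagonal fun i => ((t ^ w i : kˣ) : k)) :
    w 3 = -w 0 ∧ w 2 = -w 1 := by
  have hdet : (ρ weyl).det ≠ 0 := by
    have h1 : ρ weyl * ρ weyl⁻¹ = 1 := by rw [← map_mul, mul_inv_cancel, map_one]
    intro h0
    have := congrArg Matrix.det h1
    simp [h0] at this
  obtain ⟨π, hπ⟩ := exists_perm_weights (w := w) (w' := fun i => -w i) hdet (by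
    intro t
    have h1 : ρ (torus t) * ρ weyl = ρ weyl * ρ (torus t⁻¹) := by
      rw [← map_mul, torus_mul_weyl, map_mul]
    rw [h, h] at h1
    simpa using h1)
  have h1 : w 0 = -w (π.symm 0) := by rw [← hπ, Equiv.apply_symm_apply]
  have h2 : w (π.symm 0) ≥ w 3 := hw (Fin.le_last _)
  have h3 : w (π 3) ≤ w 0 := hw (Fin.zero_le _)
  have h4 : ∑ i, w (π i) = ∑ i, w i := Equiv.sum_comp π w
  rw [hπ] at h3
  simp only [hπ, Fin.sum_univ_four] at h4
  omega

/-- A polynomial that is homogeneous under `x ↦ t²x` is a monomial. -/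
lemma eval_eq_monomial [IsAlgClosed k] (Q : Polynomial k) (δ : ℤ)
    (h : ∀ t : kˣ, Q.eval ((t : k) ^ 2) = ((t ^ δ : kˣ) : k) * Q.eval 1) :
    (∀ x, Q.eval x = Q.eval 1 * x ^ (δ / 2).toNat) ∧
      (Q.eval 1 ≠ 0 → δ = 2 * ((δ / 2).toNat : ℤ)) := by
  have hne : Q.eval 1 ≠ 0 → δ = 2 * ((δ / 2).toNat : ℤ) := by
    intro hc
    rcases lt_or_ge δ 0 with hδ | hδ
    · exfalso
      obtain ⟨N, hN⟩ := Int.eq_ofNat_of_zero_le (show 0 ≤ -δ by omega)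
      have hN0 : N ≠ 0 := by omega
      have h1 : (Polynomial.X * (Polynomial.X ^ N * Polynomial.expand k 2 Q -
          Polynomial.C (Q.eval 1)) : Polynomial k) = 0 := by
        apply Polynomial.funext
        intro x
        by_cases hx : x = 0
        · simp [hx]
        · have h2 := h (Units.mk0 x hx)
          have h3 : δ = -(N : ℤ) := by omega
          rw [h3] at h2
          simp only [Units.val_mk0, _root_.zpow_neg, zpow_natCast] at h2
          simp [h2, hx]
      have h2 := (mul_eq_zero.mp h1).resolve_left Polynomial.X_ne_zero
      have h3 := congrArg (Polynomial.eval 0) h2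
      simp [hN0] at h3
      exact hc h3
    · obtain ⟨N, rfl⟩ := Int.eq_ofNat_of_zero_le hδ
      have h1 : (Polynomial.X * (Polynomial.expand k 2 Q -
          Polynomial.C (Q.eval 1) * Polynomial.X ^ N) : Polynomial k) = 0 := by
        apply Polynomial.funext
        intro x
        by_cases hx : x = 0
        · simp [hx]
        · have h2 := h (Units.mk0 x hx)
          simp only [Units.val_mk0, zpow_natCast, Units.val_pow_eq_pow_val] at h2
          simp only [Polynomial.eval_mul, Polynomial.eval_X, Polynomial.eval_sub, Polynomial.eval_C,
            Polynomial.eval_pow, Polynomial.eval_zero, Polynomial.expand_eval]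
          rw [h2]
          ring
      have h2 := (mul_eq_zero.mp h1).resolve_left Polynomial.X_ne_zero
      have h3 := congrArg (fun p => Polynomial.coeff p N) h2
      simp only [Polynomial.coeff_sub, Polynomial.coeff_expand two_pos,
        Polynomial.coeff_C_mul_X_pow, Polynomial.coeff_zero] at h3
      by_cases hd : 2 ∣ N
      · omega
      · simp [hd] at h3
        exact absurd h3 hc
  refine ⟨?_, hne⟩
  suffices hQ : (Polynomial.X * (Q - Polynomial.C (Q.eval 1) * Polynomial.X ^ (δ / 2).toNat) :
      Polynomial k) = 0 by
    intro x
    have h2 := (mul_eq_zero.mp hQ).resolve_left Polynomial.X_ne_zero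
    have h3 := congrArg (Polynomial.eval x) h2
    simpa [sub_eq_zero] using h3
  apply Polynomial.funext
  intro x
  by_cases hx : x = 0
  · simp [hx]
  · obtain ⟨t, ht⟩ := IsAlgClosed.exists_pow_nat_eq x two_pos
    have ht0 : t ≠ 0 := by
      rintro rfl
      simp at ht
      exact hx ht.symm
    have h2 := h (Units.mk0 t ht0)
    simp only [Units.val_mk0, ht] at h2
    by_cases hc : Q.eval 1 = 0
    · simp [h2, hc]
    · have h3 := hne hc
      generalize (δ / 2).toNat = e at h3 ⊢
      subst h3
      simp only [Units.val_zpow_eq_zpow_val, Units.val_mk0] at h2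
      have h4 : t ^ (2 * (e : ℤ)) = x ^ e := by
        rw [← ht, ← pow_mul]
        exact_mod_cast rfl
      rw [h4] at h2
      simp only [Polynomial.eval_mul, Polynomial.eval_X, Polynomial.eval_sub, Polynomial.eval_C,
        Polynomial.eval_pow, Polynomial.eval_zero]
      rw [h2]
      ring

lemma exists_polynomial_upper (ρ : (SL₂ k) → M₄ k) (hρ : IsPolyEntries ρ) (i j : Fin 4) :
    ∃ Q : Polynomial k, ∀ x, ρ (upper x) i j = Q.eval x := by
  obtain ⟨P, hP⟩ := hρ i j
  refine ⟨MvPolynomial.aeval (fun ij : Fin 2 × Fin 2 =>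
    (!![1, Polynomial.X; 0, 1] : Matrix (Fin 2) (Fin 2) (Polynomial k)) ij.1 ij.2) P,
    fun x => ?_⟩
  rw [hP, ← Polynomial.coe_evalRingHom, MvPolynomial.aeval_def, MvPolynomial.hom_eval₂]
  rw [← MvPolynomial.eval₂_id]
  congr 1
  · ext a; simp
  · ext ⟨a, b⟩
    fin_cases a <;> fin_cases b <;> simp [coe_upper]

lemma exists_polynomial_lower (ρ : (SL₂ k) → M₄ k) (hρ : IsPolyEntries ρ) (i j : Fin 4) :
    ∃ Q : Polynomial k, ∀ x, ρ (lower x) i j = Q.eval x := by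
  obtain ⟨P, hP⟩ := hρ i j
  refine ⟨MvPolynomial.aeval (fun ij : Fin 2 × Fin 2 =>
    (!![1, 0; Polynomial.X, 1] : Matrix (Fin 2) (Fin 2) (Polynomial k)) ij.1 ij.2) P,
    fun x => ?_⟩
  rw [hP, ← Polynomial.coe_evalRingHom, MvPolynomial.aeval_def, MvPolynomial.hom_eval₂]
  rw [← MvPolynomial.eval₂_id]
  congr 1
  · ext a; simp
  · ext ⟨a, b⟩
    fin_cases a <;> fin_cases b <;> simp [coe_lower]

end Weights

section Binomials

variable {k : Type*} [Field k]

/-- Modulo two, `choose m (2 ^ a)` is the `a`-th binary digit of `m`. -/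
lemma choose_two_pow [CharP k 2] (m a : ℕ) : (m.choose (2 ^ a) : k) = ((m / 2 ^ a : ℕ) : k) := by
  rw [CharP.natCast_eq_natCast' k 2]
  induction a generalizing m with
  | zero => simp [Nat.ModEq]
  | succ a ih =>
    have : Fact (Nat.Prime 2) := ⟨Nat.prime_two⟩
    have h := Choose.choose_modEq_choose_mod_mul_choose_div_nat (p := 2) (n := m) (k := 2 ^ (a + 1))
    have h1 : 2 ^ (a + 1) % 2 = 0 := by rw [pow_succ]; simp
    have h2 : 2 ^ (a + 1) / 2 = 2 ^ a := by rw [pow_succ]; simp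
    rw [h1, h2, Nat.choose_zero_right, one_mul] at h
    refine h.trans ((ih _).trans ?_)
    rw [Nat.div_div_eq_div_mul, pow_succ']

lemma eq_two_pow_or_two_digits [CharP k 2] {m : ℕ} (hm : 0 < m) :
    (∃ a, m = 2 ^ a) ∨ ∃ b a, b < a ∧ 2 ^ a < m ∧ (m.choose (2 ^ a) : k) = 1 ∧
      (m.choose (2 ^ b) : k) = 1 := by
  have ha1 : 2 ^ Nat.log 2 m ≤ m := Nat.pow_log_le_self 2 hm.ne'
  have ha2 : m < 2 ^ (Nat.log 2 m + 1) := Nat.lt_pow_succ_log_self one_lt_two m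
  generalize Nat.log 2 m = a at ha1 ha2
  rcases ha1.eq_or_lt with h | h
  · exact Or.inl ⟨a, h.symm⟩
  right
  have hr : m - 2 ^ a ≠ 0 := by omega
  have hb1 : 2 ^ Nat.log 2 (m - 2 ^ a) ≤ m - 2 ^ a := Nat.pow_log_le_self 2 hr
  have hb2 : m - 2 ^ a < 2 ^ (Nat.log 2 (m - 2 ^ a) + 1) :=
    Nat.lt_pow_succ_log_self one_lt_two _
  generalize Nat.log 2 (m - 2 ^ a) = b at hb1 hb2
  have hba : b < a := by
    by_contra! hab
    have := Nat.pow_le_pow_right two_pos hab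
    rw [pow_succ] at ha2
    omega
  refine ⟨b, a, hba, h, ?_, ?_⟩
  · rw [choose_two_pow]
    have : m / 2 ^ a = 1 := by
      apply Nat.div_eq_of_lt_le <;> rw [pow_succ] at * <;> omega
    simp [this]
  · rw [choose_two_pow]
    obtain ⟨e, rfl⟩ := Nat.exists_eq_add_of_lt hba
    have : m / 2 ^ b = 2 * 2 ^ e + 1 := by
      have h1 : 2 ^ (b + e + 1) = 2 * 2 ^ e * 2 ^ b := by ring
      apply Nat.div_eq_of_lt_le
      · rw [add_mul]; omega
      · rw [add_mul, add_mul]; rw [pow_succ] at hb2; omega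
    rw [this]
    push_cast
    simp [CharTwo.two_eq_zero]

lemma coeff_identity [Infinite k] {r s A B C : k} {m α β γ : ℕ}
    (h : ∀ z : k, 1 + z ≠ 0 → r * (1 + z) ^ m = s + A * z ^ α + B * z ^ β + C * z ^ γ) (j : ℕ) :
    r * (m.choose j : k) = (if j = 0 then s else 0) + (if j = α then A else 0) +
      (if j = β then B else 0) + (if j = γ then C else 0) := by
  open Polynomial in
  have h1 : (1 + X : k[X]) * (Polynomial.C r * (1 + X) ^ m - (Polynomial.C s +
      Polynomial.C A * X ^ α + Polynomial.C B * X ^ β + Polynomial.C C * X ^ γ)) = 0 := by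
    apply Polynomial.funext
    intro z
    by_cases hz : 1 + z = 0
    · simp [hz]
    · simp [h z hz]
  open Polynomial in
  have hX : (1 + X : k[X]) ≠ 0 := by
    intro h0
    have := congrArg (Polynomial.eval 0) h0
    simp at this
  have h2 := sub_eq_zero.mp ((mul_eq_zero.mp h1).resolve_left hX)
  have h3 := congrArg (fun p => Polynomial.coeff p j) h2
  simpa [Polynomial.coeff_one_add_X_pow, Polynomial.coeff_C, Polynomial.coeff_X_pow] using h3

lemma binomial_four_terms [CharP k 2] [Infinite k] {A B C : k} {m α β : ℕ}
    (hαβ : α < β) (hβ : β < m)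
    (h : ∀ z : k, 1 + z ≠ 0 → (1 + z) ^ m = 1 + A * z ^ α + B * z ^ β + C * z ^ m) :
    C = 1 ∧ ((A = 0 ∧ B = 0 ∧ ∃ a, m = 2 ^ a) ∨
      (A = 1 ∧ B = 1 ∧ ∃ b a, b < a ∧ α = 2 ^ b ∧ β = 2 ^ a)) := by
  have hj := coeff_identity (r := (1 : k)) (s := 1) (m := m) (by simpa using h)
  have hC : C = 1 := by
    have := hj m
    simp [show m ≠ 0 by omega, show m ≠ α by omega, show m ≠ β by omega] at this
    exact this.symm
  refine ⟨hC, ?_⟩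
  rcases eq_two_pow_or_two_digits (k := k) (show 0 < m by omega) with
    ⟨a, ha⟩ | ⟨b, a, hba, ham, h1, h2⟩
  · left
    have h0 := coeff_identity (r := (0 : k)) (s := 0) (A := A) (B := B) (C := 0) (m := 0) (α := α)
      (β := β) (γ := 0) (by
        intro z hz
        have := h z hz
        rw [hC, ha, add_pow_char_pow, one_pow] at this
        linear_combination this)
    refine ⟨?_, ?_, a, ha⟩
    · have := h0 α
      simpa [show α ≠ β by omega] using this.symm
    · have := h0 β
      simpa [show β ≠ α by omega] using this.symm
  · right
    have hlt : 2 ^ b < 2 ^ a := Nat.pow_lt_pow_right one_lt_two hba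
    have hb0 : 0 < 2 ^ b := by positivity
    have ja := hj (2 ^ a)
    have jb := hj (2 ^ b)
    simp only [h1, h2, show 2 ^ a ≠ 0 by omega, show 2 ^ b ≠ 0 by omega, show 2 ^ a ≠ m by omega,
      show 2 ^ b ≠ m by omega, if_false] at ja jb
    have hα' : 2 ^ b = α := by
      by_contra hne
      rw [if_neg hne] at jb
      have hbβ : 2 ^ b = β := by
        by_contra hne'
        simp [hne'] at jb
      simp [show 2 ^ a ≠ α by omega, show 2 ^ a ≠ β by omega] at ja
    have hβ' : 2 ^ a = β := by
      by_contra hne'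
      simp [hne', show 2 ^ a ≠ α by omega] at ja
    simp only [hα', show α ≠ β by omega, hβ', show β ≠ α by omega, if_true, if_false] at ja jb
    refine ⟨?_, ?_, b, a, hba, hα'.symm, hβ'.symm⟩
    · simpa using jb.symm
    · simpa using ja.symm

lemma binomial_three_terms [CharP k 2] [Infinite k] {A C : k} {m α : ℕ}
    (hα : 0 < α) (hm : α < m)
    (h : ∀ z : k, 1 + z ≠ 0 → (1 + z) ^ m = 1 + A * z ^ α + C * z ^ m) :
    A = 0 ∧ C = 1 ∧ ∃ a, m = 2 ^ a := by
  obtain ⟨hC, ⟨-, hA, ha⟩ | ⟨-, -, b, a, -, hb, -⟩⟩ :=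
    binomial_four_terms (A := 0) (α := 0) (β := α) (B := A) (C := C) hα hm
      (by simpa using h)
  · exact ⟨hA, hC, ha⟩
  · exact absurd hb.symm (by positivity)

lemma binomial_two_terms [CharP k 2] [Infinite k] {C : k} {m : ℕ} (hm : 0 < m)
    (h : ∀ z : k, 1 + z ≠ 0 → (1 + z) ^ m = 1 + C * z ^ m) : C = 1 ∧ ∃ a, m = 2 ^ a := by
  rcases eq_or_lt_of_le (show 1 ≤ m by omega) with rfl | hm'
  · refine ⟨?_, 0, rfl⟩
    have := coeff_identity (r := (1 : k)) (s := 1) (A := 0) (B := 0) (C := C) (m := 1) (α := 0)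
      (β := 0) (γ := 1) (by simpa using h) 1
    simpa using this.symm
  · exact (binomial_three_terms (A := 0) one_pos hm' (by simpa using h)).2

end Binomials

section NormalForm

variable {k : Type*} [Field k]

/-- Upper unitriangular matrix with monomial entries for the weights `m, n, -n, -m`. -/
def monoForm (c : M₄ k) (m n : ℕ) (x : k) : M₄ k :=
  !![1, c 0 1 * x ^ ((m - n) / 2), c 0 2 * x ^ ((m + n) / 2), c 0 3 * x ^ m;
     0, 1, c 1 2 * x ^ n, c 1 3 * x ^ ((m + n) / 2);
     0, 0, 1, c 2 3 * x ^ ((m - n) / 2);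
     0, 0, 0, 1]

/-- Vanishing conditions on the coefficients forced by the weights `m, n, -n, -m`. -/
structure Admissible (c : M₄ k) (m n : ℕ) : Prop where
  parity : m % 2 ≠ n % 2 → c 0 1 = 0 ∧ c 0 2 = 0 ∧ c 1 3 = 0 ∧ c 2 3 = 0
  of_eq : m = n → c 0 1 = 0 ∧ c 2 3 = 0
  of_snd_eq_zero : n = 0 → c 1 2 = 0
  of_fst_eq_zero : m = 0 → c 0 2 = 0 ∧ c 0 3 = 0 ∧ c 1 3 = 0

/-- A representation written in an ordered basis of weight vectors. -/
structure NormalForm (ρ : (SL₂ k) →* M₄ k) (m n : ℕ) (c d : M₄ k) : Prop where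
  le : n ≤ m
  torus_eq : ∀ t : kˣ, ρ (torus t) =
    Matrix.diagonal ![(t : k) ^ m, (t : k) ^ n, ((t : k) ^ n)⁻¹, ((t : k) ^ m)⁻¹]
  upper_eq : ∀ x, ρ (upper x) = monoForm c m n x
  lower_eq : ∀ y, ρ (lower y) = (monoForm d m n y)ᵀ
  upper_admissible : Admissible c m n
  lower_admissible : Admissible d m n

lemma monoForm_of_homogeneous [IsAlgClosed k] (F : k → M₄ k) (h0 : F 0 = 1)
    (hF : ∀ i j, ∃ Q : Polynomial k, ∀ x, F x i j = Q.eval x) (m n : ℕ) (hmn : n ≤ m)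
    (w : Fin 4 → ℤ) (hw : w = ![(m : ℤ), n, -n, -m])
    (h : ∀ (t : kˣ) i j, F ((t : k) ^ 2) i j = ((t ^ (w i - w j) : kˣ) : k) * F 1 i j) :
    (∀ x, F x = monoForm (F 1) m n x) ∧ Admissible (F 1) m n := by
  have hmono : ∀ i j, (∀ x, F x i j = F 1 i j * x ^ ((w i - w j) / 2).toNat) ∧
      (F 1 i j ≠ 0 → w i - w j = 2 * (((w i - w j) / 2).toNat : ℤ)) := by
    intro i j
    obtain ⟨Q, hQ⟩ := hF i j
    have := eval_eq_monomial Q (w i - w j) (fun t => by rw [← hQ, ← hQ]; exact h t i j)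
    simpa only [← hQ] using this
  have hzero : ∀ i j, w i < w j → F 1 i j = 0 := by
    intro i j hij
    by_contra hne
    have := (hmono i j).2 hne
    omega
  have hodd : ∀ i j, (w i - w j) % 2 ≠ 0 → F 1 i j = 0 := by
    intro i j hij
    by_contra hne
    have := (hmono i j).2 hne
    omega
  have hconst : ∀ i j, w i = w j → F 1 i j = (1 : M₄ k) i j := by
    intro i j hij
    have := (hmono i j).1 0
    rw [hij, h0] at this
    simpa using this.symm
  have hdiag : ∀ i, F 1 i i = 1 := fun i => by simp [hconst i i rfl]
  have hle : ∀ i j, w i ≤ w j → i ≠ j → F 1 i j = 0 := by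
    intro i j hij hne
    rcases hij.lt_or_eq with h1 | h1
    · exact hzero i j h1
    · simp [hconst i j h1, hne]
  have e0 : w 0 = m := by simp [hw]
  have e1 : w 1 = n := by simp [hw]
  have e2 : w 2 = -n := by simp [hw]
  have e3 : w 3 = -m := by simp [hw]
  constructor
  · intro x
    have t01 : ((w 0 - w 1) / 2).toNat = (m - n) / 2 := by omega
    have t02 : ((w 0 - w 2) / 2).toNat = (m + n) / 2 := by omega
    have t03 : ((w 0 - w 3) / 2).toNat = m := by omega
    have t12 : ((w 1 - w 2) / 2).toNat = n := by omega
    have t13 : ((w 1 - w 3) / 2).toNat = (m + n) / 2 := by omega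
    have t23 : ((w 2 - w 3) / 2).toNat = (m - n) / 2 := by omega
    have l10 := hle 1 0 (by omega) (by decide)
    have l20 := hle 2 0 (by omega) (by decide)
    have l30 := hle 3 0 (by omega) (by decide)
    have l21 := hle 2 1 (by omega) (by decide)
    have l31 := hle 3 1 (by omega) (by decide)
    have l32 := hle 3 2 (by omega) (by decide)
    ext i j
    rw [(hmono i j).1 x]
    fin_cases i <;> fin_cases j <;>
      simp [monoForm, t01, t02, t03, t12, t13, t23, l10, l20, l30, l21, l31, l32, hdiag]
  · refine ⟨fun hp => ⟨?_, ?_, ?_, ?_⟩, fun hp => ⟨?_, ?_⟩, fun hp => ?_, fun hp => ⟨?_, ?_, ?_⟩⟩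
    · exact hodd 0 1 (by omega)
    · exact hodd 0 2 (by omega)
    · exact hodd 1 3 (by omega)
    · exact hodd 2 3 (by omega)
    · exact hle 0 1 (by omega) (by decide)
    · exact hle 2 3 (by omega) (by decide)
    · exact hle 1 2 (by omega) (by decide)
    · exact hle 0 2 (by omega) (by decide)
    · exact hle 0 3 (by omega) (by decide)
    · exact hle 1 3 (by omega) (by decide)

lemma isPolyEntries_conjHom {f : (SL₂ k) →* M₄ k} (hf : IsPolyEntries f) (Q : GL (Fin 4) k) :
    IsPolyEntries (conjHom f Q) := by
  intro i j
  choose p hp using hf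
  refine ⟨∑ b, (∑ a, MvPolynomial.C (((Q⁻¹ : GL (Fin 4) k) : M₄ k) i a) * p a b) *
    MvPolynomial.C ((Q : M₄ k) b j), fun A => ?_⟩
  change (((Q⁻¹ : GL (Fin 4) k) : M₄ k) * f A * (Q : M₄ k)) i j = _
  simp [Matrix.mul_apply, hp]

/-- Every rational representation can be brought to normal form. -/
lemma exists_normalForm [IsAlgClosed k] (f : (SL₂ k) →* M₄ k) (hf : IsPolyEntries f) :
    ∃ (ρ : (SL₂ k) →* M₄ k) (m n : ℕ) (c d : M₄ k), MatEquiv f ρ ∧ NormalForm ρ m n c d := by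
  have : Infinite k := IsAlgClosed.instInfinite
  obtain ⟨P, w, hw, hP⟩ := exists_weight_basis f hf
  set ρ := conjHom f P with hρ
  have hpoly := isPolyEntries_conjHom hf P
  have hT : ∀ t, ρ (torus t) = Matrix.diagonal fun i => ((t ^ w i : kˣ) : k) := by
    intro t
    change ((P⁻¹ : GL (Fin 4) k) : M₄ k) * f (torus t) * (P : M₄ k) = _
    rw [mul_assoc, hP, Units.inv_mul_cancel_left]
  obtain ⟨h3, h2⟩ := weights_symm ρ hw hT
  have h01 : w 1 ≤ w 0 := hw (by decide)
  have h12 : w 2 ≤ w 1 := hw (by decide)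
  obtain ⟨m, hm⟩ := Int.eq_ofNat_of_zero_le (show 0 ≤ w 0 by omega)
  obtain ⟨n, hn⟩ := Int.eq_ofNat_of_zero_le (show 0 ≤ w 1 by omega)
  have hmn : n ≤ m := by omega
  have hwv : w = ![(m : ℤ), n, -n, -m] := by
    ext i
    fin_cases i <;> simp [hm, hn, h2, h3]
  have hU := monoForm_of_homogeneous (fun x => ρ (upper x)) (by simp [upper_zero])
    (exists_polynomial_upper ρ hpoly) m n hmn w hwv (by
      intro t i j
      have h1 : ρ (torus t) * ρ (upper 1) = ρ (upper ((t : k) ^ 2)) * ρ (torus t) := by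
        rw [← map_mul, torus_mul_upper, map_mul, mul_one]
      have h2 := congrFun (congrFun h1 i) j
      rw [hT, Matrix.diagonal_mul, Matrix.mul_diagonal] at h2
      rw [_root_.zpow_sub, Units.val_mul, mul_right_comm, h2, mul_assoc, ← Units.val_mul,
        mul_inv_cancel, Units.val_one, mul_one])
  have hL := monoForm_of_homogeneous (fun x => (ρ (lower x))ᵀ) (by simp [lower_zero])
    (fun i j => exists_polynomial_lower ρ hpoly j i) m n hmn w hwv (by
      intro t i j
      have h1 : ρ (lower 1) * ρ (torus t) = ρ (torus t) * ρ (lower ((t : k) ^ 2)) := by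
        rw [← map_mul, lower_mul_torus, map_mul, mul_one]
      have h2 := congrFun (congrFun h1 j) i
      rw [hT, Matrix.diagonal_mul, Matrix.mul_diagonal] at h2
      simp only [Matrix.transpose_apply]
      rw [sub_eq_neg_add, _root_.zpow_add, Units.val_mul, mul_assoc, mul_comm ((t ^ w i : kˣ) : k),
        h2, ← mul_assoc, ← Units.val_mul, _root_.zpow_neg, inv_mul_cancel, Units.val_one, one_mul])
  refine ⟨ρ, m, n, _, _, ⟨P, fun A => rfl⟩, hmn, ?_, hU.1, ?_, hU.2, hL.2⟩
  · intro t
    rw [hT, hwv]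
    congr 1
    ext i
    fin_cases i <;> simp
  · intro y
    rw [← hL.1 y, Matrix.transpose_transpose]

end NormalForm

section Relations

variable {k : Type*} [Field k]

/-- The monomial form is a one-parameter group. -/
def IsAdditive (c : M₄ k) (m n : ℕ) : Prop :=
  ∀ x y, monoForm c m n (x + y) = monoForm c m n x * monoForm c m n y

lemma NormalForm.upper_isAdditive {ρ : (SL₂ k) →* M₄ k} {m n : ℕ} {c d : M₄ k}
    (h : NormalForm ρ m n c d) : IsAdditive c m n := fun x y => by
  rw [← h.upper_eq, ← h.upper_eq, ← h.upper_eq, upper_add, map_mul]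

lemma NormalForm.lower_isAdditive {ρ : (SL₂ k) →* M₄ k} {m n : ℕ} {c d : M₄ k}
    (h : NormalForm ρ m n c d) : IsAdditive d m n := fun x y => by
  rw [← Matrix.transpose_inj, Matrix.transpose_mul, ← h.lower_eq, ← h.lower_eq, ← h.lower_eq,
    add_comm, lower_add, map_mul]

lemma NormalForm.cross {ρ : (SL₂ k) →* M₄ k} {m n : ℕ} {c d : M₄ k}
    (h : NormalForm ρ m n c d) (z : k) (hz : 1 + z ≠ 0) :
    monoForm c m n 1 * (monoForm d m n z)ᵀ =
      (monoForm d m n (z / (1 + z)))ᵀ * Matrix.diagonal ![(1 + z) ^ m, (1 + z) ^ n,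
        ((1 + z) ^ n)⁻¹, ((1 + z) ^ m)⁻¹] * monoForm c m n (1 / (1 + z)) := by
  have := congrArg ρ (upper_mul_lower z (Units.mk0 (1 + z) hz) rfl)
  simpa only [map_mul, h.upper_eq, h.lower_eq, h.torus_eq, Units.val_mk0] using this

lemma IsAdditive.entry_zero_two {c : M₄ k} {m n : ℕ} (h : IsAdditive c m n) (x y : k) :
    c 0 2 * (x + y) ^ ((m + n) / 2) = c 0 2 * x ^ ((m + n) / 2) +
      c 0 1 * c 1 2 * (x ^ ((m - n) / 2) * y ^ n) + c 0 2 * y ^ ((m + n) / 2) := by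
  have := congrFun (congrFun (h x y) 0) 2
  simp [monoForm, Matrix.mul_apply, Fin.sum_univ_four] at this
  linear_combination this

lemma IsAdditive.entry_one_three {c : M₄ k} {m n : ℕ} (h : IsAdditive c m n) (x y : k) :
    c 1 3 * (x + y) ^ ((m + n) / 2) = c 1 3 * x ^ ((m + n) / 2) +
      c 1 2 * c 2 3 * (x ^ n * y ^ ((m - n) / 2)) + c 1 3 * y ^ ((m + n) / 2) := by
  have := congrFun (congrFun (h x y) 1) 3
  simp [monoForm, Matrix.mul_apply, Fin.sum_univ_four] at this
  linear_combination this

lemma IsAdditive.entry_zero_three {c : M₄ k} {m n : ℕ} (h : IsAdditive c m n) (x y : k) :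
    c 0 3 * (x + y) ^ m = c 0 3 * x ^ m +
      c 0 1 * c 1 3 * (x ^ ((m - n) / 2) * y ^ ((m + n) / 2)) +
      c 0 2 * c 2 3 * (x ^ ((m + n) / 2) * y ^ ((m - n) / 2)) + c 0 3 * y ^ m := by
  have := congrFun (congrFun (h x y) 0) 3
  simp [monoForm, Matrix.mul_apply, Fin.sum_univ_four] at this
  linear_combination this

lemma IsAdditive.of_tensor [CharP k 2] [Infinite k] {c : M₄ k} {a b : ℕ} (hba : b < a)
    (h : IsAdditive c (2 ^ a + 2 ^ b) (2 ^ a - 2 ^ b)) (h1 : c 0 1 ≠ 0) :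
    c 1 2 = 0 ∧ c 0 1 * c 1 3 = c 0 3 ∧ c 0 2 * c 2 3 = c 0 3 := by
  have hlt : 2 ^ b < 2 ^ a := Nat.pow_lt_pow_right one_lt_two hba
  have hb0 : 0 < 2 ^ b := by positivity
  have eα : (2 ^ a + 2 ^ b - (2 ^ a - 2 ^ b)) / 2 = 2 ^ b := by omega
  have eβ : (2 ^ a + 2 ^ b + (2 ^ a - 2 ^ b)) / 2 = 2 ^ a := by omega
  have h02 := h.entry_zero_two 1 1
  have h03 := h.entry_zero_three 1
  simp only [eα, eβ, add_pow_char_pow, one_pow, pow_add, one_mul, mul_one] at h02 h03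
  have key := coeff_identity (r := (0 : k)) (s := 0) (m := 0) (A := c 0 1 * c 1 3 - c 0 3)
    (B := c 0 2 * c 2 3 - c 0 3) (C := 0) (α := 2 ^ a) (β := 2 ^ b) (γ := 0)
    (fun z _ => by linear_combination h03 z)
  refine ⟨?_, ?_, ?_⟩
  · have : c 0 1 * c 1 2 = 0 := by linear_combination -h02
    exact (mul_eq_zero.mp this).resolve_left h1
  · have := key (2 ^ a)
    simp [hlt.ne'] at this
    linear_combination -this
  · have := key (2 ^ b)
    simp [hlt.ne] at this
    linear_combination -this

lemma eq_zero_of_two_digits [CharP k 2] [Infinite k] {A B : k} {a b : ℕ} (hba : b < a)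
    (h : ∀ z : k, A * (1 + z) ^ (2 ^ a + 2 ^ b) =
      A + B * z ^ 2 ^ (b + 1) + A * z ^ (2 ^ a + 2 ^ b)) : A = 0 ∧ B = 0 := by
  have hlt : 2 ^ b < 2 ^ a := Nat.pow_lt_pow_right one_lt_two hba
  have hb0 : 0 < 2 ^ b := by positivity
  have hA : A = 0 := by
    have key := coeff_identity (r := A) (s := A) (A := 0) (B := B) (C := A) (α := 0)
      (fun z _ => by simpa using h z) (2 ^ b)
    obtain ⟨e, rfl⟩ := Nat.exists_eq_add_of_lt hba
    have hdiv : (2 ^ (b + e + 1) + 2 ^ b) / 2 ^ b = 2 * 2 ^ e + 1 := by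
      rw [show 2 ^ (b + e + 1) + 2 ^ b = (2 * 2 ^ e + 1) * 2 ^ b by ring]
      exact Nat.mul_div_cancel _ hb0
    rw [choose_two_pow, hdiv, if_neg hb0.ne', if_neg hb0.ne', if_neg (by rw [pow_succ]; omega),
      if_neg (by omega)] at key
    push_cast at key
    rw [CharTwo.two_eq_zero] at key
    simpa using key
  refine ⟨hA, ?_⟩
  simpa [hA] using (h 1).symm

lemma IsAdditive.of_direct_sum [CharP k 2] [Infinite k] {c : M₄ k} {a b : ℕ} (hba : b < a)
    (h : IsAdditive c (2 ^ a) (2 ^ b)) (hc : Admissible c (2 ^ a) (2 ^ b)) (h1 : c 1 2 ≠ 0) :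
    c 0 1 = 0 ∧ c 0 2 = 0 ∧ c 1 3 = 0 ∧ c 2 3 = 0 := by
  obtain ⟨a, rfl⟩ := Nat.exists_eq_succ_of_ne_zero (show a ≠ 0 by omega)
  rcases b with _ | b
  · exact hc.parity (by rw [pow_succ]; omega)
  have eβ : (2 ^ (a + 1) + 2 ^ (b + 1)) / 2 = 2 ^ a + 2 ^ b := by
    rw [pow_succ, pow_succ]; omega
  have h02 := h.entry_zero_two 1
  have h13 := fun z => h.entry_one_three z 1
  simp only [Nat.succ_eq_add_one, eβ, one_pow, one_mul, mul_one] at h02 h13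
  obtain ⟨h2, h3⟩ := eq_zero_of_two_digits (A := c 0 2) (B := c 0 1 * c 1 2) (by omega : b < a) h02
  obtain ⟨h4, h5⟩ := eq_zero_of_two_digits (A := c 1 3) (B := c 1 2 * c 2 3) (by omega : b < a)
    (fun z => by rw [add_comm, h13 z]; ring)
  exact ⟨(mul_eq_zero.mp h3).resolve_right h1, h2, h4, (mul_eq_zero.mp h5).resolve_left h1⟩

end Relations

section Cases

variable {k : Type*} [Field k] {ρ : (SL₂ k) →* M₄ k} {m n : ℕ} {c d : M₄ k}

lemma NormalForm.cross_zero_zero (h : NormalForm ρ m n c d) (z : k) (hz : 1 + z ≠ 0) :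
    (1 + z) ^ m = 1 + c 0 1 * d 0 1 * z ^ ((m - n) / 2) + c 0 2 * d 0 2 * z ^ ((m + n) / 2) +
      c 0 3 * d 0 3 * z ^ m := by
  have := congrFun (congrFun (h.cross z hz) 0) 0
  simp [monoForm, Matrix.mul_apply, Fin.sum_univ_four, Matrix.diagonal_apply] at this
  linear_combination -this

lemma NormalForm.cross_one_one (h : NormalForm ρ m n c d) (z : k) (hz : 1 + z ≠ 0) :
    (1 + z) ^ n + c 0 1 * d 0 1 * ((z / (1 + z)) ^ ((m - n) / 2) * (1 + z) ^ m *
      (1 / (1 + z)) ^ ((m - n) / 2)) =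
      1 + c 1 2 * d 1 2 * z ^ n + c 1 3 * d 1 3 * z ^ ((m + n) / 2) := by
  have := congrFun (congrFun (h.cross z hz) 1) 1
  simp [monoForm, Matrix.mul_apply, Fin.sum_univ_four, Matrix.diagonal_apply] at this
  rw [one_div, inv_pow]
  linear_combination -this

lemma NormalForm.cross_zero_one (h : NormalForm ρ m n c d) (z : k) (hz : 1 + z ≠ 0) :
    c 0 1 + c 0 2 * d 1 2 * z ^ n + c 0 3 * d 1 3 * z ^ ((m + n) / 2) =
      c 0 1 * ((1 + z) ^ m * (1 / (1 + z)) ^ ((m - n) / 2)) := by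
  have := congrFun (congrFun (h.cross z hz) 0) 1
  simp [monoForm, Matrix.mul_apply, Fin.sum_univ_four, Matrix.diagonal_apply] at this
  rw [one_div, inv_pow]
  linear_combination this

lemma NormalForm.cross_zero_two (h : NormalForm ρ m n c d) (z : k) (hz : 1 + z ≠ 0) :
    c 0 2 + c 0 3 * d 2 3 * z ^ ((m - n) / 2) =
      c 0 2 * ((1 + z) ^ m * (1 / (1 + z)) ^ ((m + n) / 2)) := by
  have := congrFun (congrFun (h.cross z hz) 0) 2
  simp [monoForm, Matrix.mul_apply, Fin.sum_univ_four, Matrix.diagonal_apply] at this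
  rw [one_div, inv_pow]
  linear_combination this

lemma NormalForm.cross_one_zero (h : NormalForm ρ m n c d) (z : k) (hz : 1 + z ≠ 0) :
    d 0 1 * z ^ ((m - n) / 2) + c 1 2 * d 0 2 * z ^ ((m + n) / 2) + c 1 3 * d 0 3 * z ^ m =
      d 0 1 * ((z / (1 + z)) ^ ((m - n) / 2) * (1 + z) ^ m) := by
  have := congrFun (congrFun (h.cross z hz) 1) 0
  simp [monoForm, Matrix.mul_apply, Fin.sum_univ_four, Matrix.diagonal_apply] at this
  linear_combination this

lemma NormalForm.cross_two_zero (h : NormalForm ρ m n c d) (z : k) (hz : 1 + z ≠ 0) :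
    d 0 2 * z ^ ((m + n) / 2) + c 2 3 * d 0 3 * z ^ m =
      d 0 2 * ((z / (1 + z)) ^ ((m + n) / 2) * (1 + z) ^ m) := by
  have := congrFun (congrFun (h.cross z hz) 2) 0
  simp [monoForm, Matrix.mul_apply, Fin.sum_univ_four, Matrix.diagonal_apply] at this
  linear_combination this

lemma listHom_apply [CharP k 2] (i : Idx15) (A : SL₂ k) : listHom i A = list15 2 i A := rfl

lemma NormalForm.matEquiv_one [CharP k 2] (h : NormalForm ρ 0 0 c d) :
    MatEquiv ρ (listHom Idx15.XXVI) := by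
  have hone : ∀ {c : M₄ k}, Admissible c 0 0 → ∀ x, monoForm c 0 0 x = 1 := by
    intro c hc x
    obtain ⟨h1, h2⟩ := hc.of_eq rfl
    obtain ⟨h3, h4, h5⟩ := hc.of_fst_eq_zero rfl
    have h6 := hc.of_snd_eq_zero rfl
    ext i j
    fin_cases i <;> fin_cases j <;> simp [monoForm, h1, h2, h3, h4, h5, h6]
  refine matEquiv_of_generators _ _ 1 (by simp) (fun x => ?_) (fun y => ?_)
  · rw [h.upper_eq, hone h.upper_admissible]
    rfl
  · rw [h.lower_eq, hone h.lower_admissible, Matrix.transpose_one]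
    rfl

lemma NormalForm.matEquiv_direct_sum [CharP k 2] {a b : ℕ} (hba : b ≤ a)
    (h : NormalForm ρ (2 ^ a) (2 ^ b) c d)
    (hc : c 0 1 = 0 ∧ c 0 2 = 0 ∧ c 1 3 = 0 ∧ c 2 3 = 0)
    (hd : d 0 1 = 0 ∧ d 0 2 = 0 ∧ d 1 3 = 0 ∧ d 2 3 = 0)
    (h03 : c 0 3 * d 0 3 = 1) (h12 : c 1 2 * d 1 2 = 1) :
    MatEquiv ρ (listHom (Idx15.XV a b hba)) := by
  obtain ⟨c1, c2, c3, c4⟩ := hc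
  obtain ⟨d1, d2, d3, d4⟩ := hd
  refine matEquiv_of_generators _ _
    !![1, 0, 0, 0; 0, 0, 1, 0; 0, 0, 0, d 1 2; 0, d 0 3, 0, 0] ?_ (fun x => ?_) (fun y => ?_)
  · simp [Matrix.det_succ_row_zero, Fin.sum_univ_succ, Fin.succAbove,
      right_ne_zero_of_mul_eq_one h03, right_ne_zero_of_mul_eq_one h12]
  · rw [h.upper_eq, listHom_apply]
    ext i j
    fin_cases i <;> fin_cases j <;>
      simp [list15, monoForm, blockDiag4, entryPow, coe_upper, Matrix.mul_apply,
        Fin.sum_univ_four, c1, c2, c3, c4]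
    · linear_combination (x ^ 2 ^ a) * h03
    · linear_combination (x ^ 2 ^ b) * h12
  · rw [h.lower_eq, listHom_apply]
    ext i j
    fin_cases i <;> fin_cases j <;>
      simp [list15, monoForm, blockDiag4, entryPow, coe_lower, Matrix.mul_apply,
        Fin.sum_univ_four, d1, d2, d3, d4]

lemma NormalForm.matEquiv_isotypic [CharP k 2] {a : ℕ} (h : NormalForm ρ (2 ^ a) (2 ^ a) c d)
    (h00 : c 0 2 * d 0 2 + c 0 3 * d 0 3 = 1) (h01 : c 0 2 * d 1 2 + c 0 3 * d 1 3 = 0)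
    (h10 : c 1 2 * d 0 2 + c 1 3 * d 0 3 = 0) (h11 : c 1 2 * d 1 2 + c 1 3 * d 1 3 = 1) :
    MatEquiv ρ (listHom (Idx15.XV a a le_rfl)) := by
  obtain ⟨c1, c2⟩ := h.upper_admissible.of_eq rfl
  obtain ⟨d1, d2⟩ := h.lower_admissible.of_eq rfl
  have eβ : (2 ^ a + 2 ^ a) / 2 = 2 ^ a := by omega
  refine matEquiv_of_generators _ _
    !![1, 0, 0, 0; 0, 0, 1, 0; 0, d 0 2, 0, d 1 2; 0, d 0 3, 0, d 1 3] ?_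
    (fun x => ?_) (fun y => ?_)
  · simp [Matrix.det_succ_row_zero, Fin.sum_univ_succ, Fin.succAbove]
    intro hdet
    have : (c 0 2 * c 1 3 - c 0 3 * c 1 2) * (d 0 2 * d 1 3 - d 1 2 * d 0 3) = 1 := by
      linear_combination (c 1 2 * d 1 2 + c 1 3 * d 1 3) * h00 + h11 -
        (c 1 2 * d 0 2 + c 1 3 * d 0 3) * h01
    refine one_ne_zero (α := k) ?_
    rw [← this]
    linear_combination -(c 0 2 * c 1 3 - c 0 3 * c 1 2) * hdet
  · rw [h.upper_eq, listHom_apply]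
    ext i j
    fin_cases i <;> fin_cases j <;>
      simp [list15, monoForm, blockDiag4, entryPow, coe_upper, Matrix.mul_apply,
        Fin.sum_univ_four, c1, c2, eβ]
    · linear_combination (x ^ 2 ^ a) * h00
    · linear_combination (x ^ 2 ^ a) * h01
    · linear_combination (x ^ 2 ^ a) * h10
    · linear_combination (x ^ 2 ^ a) * h11
  · rw [h.lower_eq, listHom_apply]
    ext i j
    fin_cases i <;> fin_cases j <;>
      simp [list15, monoForm, blockDiag4, entryPow, coe_lower, Matrix.mul_apply,
        Fin.sum_univ_four, d1, d2, eβ]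

lemma NormalForm.matEquiv_tensor [CharP k 2] [Infinite k] {a b : ℕ} (hba : b < a)
    (h : NormalForm ρ (2 ^ a + 2 ^ b) (2 ^ a - 2 ^ b) c d)
    (h01 : c 0 1 * d 0 1 = 1) (h02 : c 0 2 * d 0 2 = 1) (h03 : c 0 3 * d 0 3 = 1) :
    MatEquiv ρ (listHom (Idx15.IV b a hba)) := by
  obtain ⟨c1, c2, c3⟩ := h.upper_isAdditive.of_tensor hba (left_ne_zero_of_mul_eq_one h01)
  obtain ⟨d1, d2, d3⟩ := h.lower_isAdditive.of_tensor hba (right_ne_zero_of_mul_eq_one h01)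
  have hlt : 2 ^ b < 2 ^ a := Nat.pow_lt_pow_right one_lt_two hba
  have hb0 : 0 < 2 ^ b := by positivity
  have eα : (2 ^ a + 2 ^ b - (2 ^ a - 2 ^ b)) / 2 = 2 ^ b := by omega
  have eβ : (2 ^ a + 2 ^ b + (2 ^ a - 2 ^ b)) / 2 = 2 ^ a := by omega
  refine matEquiv_of_generators _ _
    !![1, 0, 0, 0; 0, d 0 1, 0, 0; 0, 0, d 0 2, 0; 0, 0, 0, d 0 3] ?_ (fun x => ?_) (fun y => ?_)
  · simp [Matrix.det_succ_row_zero, Fin.sum_univ_succ, Fin.succAbove,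
      right_ne_zero_of_mul_eq_one h01, right_ne_zero_of_mul_eq_one h02,
      right_ne_zero_of_mul_eq_one h03]
  · rw [h.upper_eq, listHom_apply]
    ext i j
    fin_cases i <;> fin_cases j <;>
      simp [list15, monoForm, kron4, entryPow, coe_upper, Matrix.mul_apply,
        Fin.sum_univ_four, c1, eα, eβ, pow_add]
    · linear_combination (x ^ 2 ^ b) * h01
    · linear_combination (x ^ 2 ^ a) * h02
    · linear_combination (x ^ 2 ^ a * x ^ 2 ^ b) * h03
    · linear_combination (x ^ 2 ^ a) *
        (d 0 1 * h03 + d 0 1 * d 0 3 * c2 - c 1 3 * d 0 3 * h01)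
    · linear_combination (x ^ 2 ^ b) *
        (d 0 2 * h03 + d 0 2 * d 0 3 * c3 - c 2 3 * d 0 3 * h02)
  · rw [h.lower_eq, listHom_apply]
    ext i j
    fin_cases i <;> fin_cases j <;>
      simp [list15, monoForm, kron4, entryPow, coe_lower, Matrix.mul_apply,
        Fin.sum_univ_four, d1, eα, eβ, pow_add]
    · linear_combination (y ^ 2 ^ a) * d2
    · linear_combination (y ^ 2 ^ b) * d3

lemma NormalForm.matEquiv_standard [CharP k 2] {a : ℕ}
    (h : NormalForm ρ (2 ^ a) 0 c d)
    (hc : c 0 1 = 0 ∧ c 0 2 = 0 ∧ c 1 3 = 0 ∧ c 2 3 = 0)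
    (hd : d 0 1 = 0 ∧ d 0 2 = 0 ∧ d 1 3 = 0 ∧ d 2 3 = 0) (h03 : c 0 3 * d 0 3 = 1) :
    MatEquiv ρ (listHom (Idx15.XXIV a)) := by
  obtain ⟨c1, c2, c3, c4⟩ := hc
  obtain ⟨d1, d2, d3, d4⟩ := hd
  have c5 := h.upper_admissible.of_snd_eq_zero rfl
  have d5 := h.lower_admissible.of_snd_eq_zero rfl
  refine matEquiv_of_generators _ _
    !![1, 0, 0, 0; 0, 0, 1, 0; 0, 0, 0, 1; 0, d 0 3, 0, 0] ?_ (fun x => ?_) (fun y => ?_)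
  · simp [Matrix.det_succ_row_zero, Fin.sum_univ_succ, Fin.succAbove,
      right_ne_zero_of_mul_eq_one h03]
  · rw [h.upper_eq, listHom_apply]
    ext i j
    fin_cases i <;> fin_cases j <;>
      simp [list15, monoForm, blockDiag4, entryPow, coe_upper, Matrix.mul_apply,
        Fin.sum_univ_four, c1, c2, c3, c4, c5]
    linear_combination (x ^ 2 ^ a) * h03
  · rw [h.lower_eq, listHom_apply]
    ext i j
    fin_cases i <;> fin_cases j <;>
      simp [list15, monoForm, blockDiag4, entryPow, coe_lower, Matrix.mul_apply,
        Fin.sum_univ_four, d1, d2, d3, d4, d5]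

/-- The relations between the coefficients when the weight zero occurs twice. -/
structure ZeroWeightRelations (c d : M₄ k) : Prop where
  dual : c 0 3 * d 0 3 = 1
  row_one : d 1 3 = d 0 3 * c 0 1
  row_two : d 2 3 = d 0 3 * c 0 2
  col_one : c 1 3 = c 0 3 * d 0 1
  col_two : c 2 3 = c 0 3 * d 0 2
  orth : c 0 1 * d 0 1 + c 0 2 * d 0 2 = 0

lemma exists_dual_vector {r s : k} (h : ¬(r = 0 ∧ s = 0)) : ∃ v w : k, r * v + s * w = 1 := by
  by_cases hr : r = 0
  · exact ⟨0, s⁻¹, by simp [mul_inv_cancel₀ (fun hs => h ⟨hr, hs⟩)]⟩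
  · exact ⟨r⁻¹, 0, by simp [hr]⟩

lemma NormalForm.matEquiv_lower_extension [CharP k 2] {e : ℕ}
    (h : NormalForm ρ (2 * 2 ^ e) 0 c d) (hr : ZeroWeightRelations c d)
    (hrow : c 0 1 = 0 ∧ c 0 2 = 0) (hcol : ¬(d 0 1 = 0 ∧ d 0 2 = 0)) :
    MatEquiv ρ (listHom (Idx15.XIX e)) := by
  obtain ⟨h03, r1, r2, s1, s2, -⟩ := hr
  have c5 := h.upper_admissible.of_snd_eq_zero rfl
  have d5 := h.lower_admissible.of_snd_eq_zero rfl
  obtain ⟨c1, c2⟩ := hrow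
  obtain ⟨v, w, hv⟩ := exists_dual_vector hcol
  refine matEquiv_of_generators _ _
    !![1, 0, 0, 0; 0, 0, d 0 1, -w; 0, 0, d 0 2, v; 0, d 0 3, 0, 0] ?_
    (fun x => ?_) (fun y => ?_)
  · simp [Matrix.det_succ_row_zero, Fin.sum_univ_succ, Fin.succAbove]
    intro h0
    refine right_ne_zero_of_mul_eq_one h03 ?_
    linear_combination h0 - d 0 3 * hv
  · rw [h.upper_eq, listHom_apply]
    ext i j
    fin_cases i <;> fin_cases j <;>
      simp [list15, monoForm, famXIX, coe_upper, Matrix.mul_apply,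
        Fin.sum_univ_four, c1, c2, s1, s2, c5]
    · linear_combination (x ^ (2 * 2 ^ e)) * h03
    · linear_combination (d 0 1 * x ^ 2 ^ e) * h03
    · linear_combination (d 0 2 * x ^ 2 ^ e) * h03
  · rw [h.lower_eq, listHom_apply]
    ext i j
    fin_cases i <;> fin_cases j <;>
      simp [list15, monoForm, famXIX, coe_lower, Matrix.mul_apply,
        Fin.sum_univ_four, c1, c2, r1, r2, d5]

lemma NormalForm.matEquiv_upper_extension [CharP k 2] {e : ℕ}
    (h : NormalForm ρ (2 * 2 ^ e) 0 c d) (hr : ZeroWeightRelations c d)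
    (hrow : ¬(c 0 1 = 0 ∧ c 0 2 = 0)) (hcol : d 0 1 = 0 ∧ d 0 2 = 0) :
    MatEquiv ρ (listHom (Idx15.XI e)) := by
  obtain ⟨h03, r1, r2, s1, s2, -⟩ := hr
  have c5 := h.upper_admissible.of_snd_eq_zero rfl
  have d5 := h.lower_admissible.of_snd_eq_zero rfl
  obtain ⟨v, w, hv⟩ := exists_dual_vector hrow
  obtain ⟨d1, d2⟩ := hcol
  refine matEquiv_of_generators _ _
    !![1, 0, 0, 0; 0, 0, v, -c 0 2; 0, 0, w, c 0 1; 0, d 0 3, 0, 0] ?_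
    (fun x => ?_) (fun y => ?_)
  · simp [Matrix.det_succ_row_zero, Fin.sum_univ_succ, Fin.succAbove]
    intro h0
    refine right_ne_zero_of_mul_eq_one h03 ?_
    linear_combination h0 - d 0 3 * hv
  · rw [h.upper_eq, listHom_apply]
    ext i j
    fin_cases i <;> fin_cases j <;>
      simp [list15, monoForm, famXI, coe_upper, Matrix.mul_apply,
        Fin.sum_univ_four, d1, d2, s1, s2, c5]
    · linear_combination (x ^ (2 * 2 ^ e)) * h03
    · linear_combination (x ^ 2 ^ e) * hv
    · ring
  · rw [h.lower_eq, listHom_apply]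
    ext i j
    fin_cases i <;> fin_cases j <;>
      simp [list15, monoForm, famXI, coe_lower, Matrix.mul_apply,
        Fin.sum_univ_four, d1, d2, r1, r2, d5]
    · linear_combination (d 0 3 * y ^ 2 ^ e) * hv
    · ring

lemma NormalForm.matEquiv_uniserial [CharP k 2] {e : ℕ}
    (h : NormalForm ρ (2 * 2 ^ e) 0 c d) (hr : ZeroWeightRelations c d)
    (hrow : ¬(c 0 1 = 0 ∧ c 0 2 = 0)) (hcol : ¬(d 0 1 = 0 ∧ d 0 2 = 0)) :
    MatEquiv ρ (listHom (Idx15.V e)) := by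
  obtain ⟨h03, r1, r2, s1, s2, ho⟩ := hr
  have c5 := h.upper_admissible.of_snd_eq_zero rfl
  have d5 := h.lower_admissible.of_snd_eq_zero rfl
  obtain ⟨v, w, hv⟩ := exists_dual_vector hrow
  refine matEquiv_of_generators _ _
    !![0, 1, 0, 0; v, 0, 0, d 0 1; w, 0, 0, d 0 2; 0, 0, d 0 3, 0] ?_
    (fun x => ?_) (fun y => ?_)
  · simp [Matrix.det_succ_row_zero, Fin.sum_univ_succ, Fin.succAbove]
    intro h0
    have hne := right_ne_zero_of_mul_eq_one h03
    have h1 : d 0 3 * (v * d 0 2 - w * d 0 1) = 0 := by linear_combination h0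
    have h2 := (mul_eq_zero.mp h1).resolve_left hne
    refine hcol ⟨?_, ?_⟩
    · linear_combination -d 0 1 * hv + v * ho - c 0 2 * h2
    · linear_combination -d 0 2 * hv + w * ho + c 0 1 * h2
  · rw [h.upper_eq, listHom_apply]
    ext i j
    fin_cases i <;> fin_cases j <;>
      simp [list15, monoForm, famV, coe_upper, Matrix.mul_apply,
        Fin.sum_univ_four, s1, s2, c5]
    · linear_combination (x ^ 2 ^ e) * hv
    · linear_combination (x ^ (2 * 2 ^ e)) * h03
    · linear_combination (x ^ 2 ^ e) * ho
    · linear_combination (d 0 1 * x ^ 2 ^ e) * h03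
    · linear_combination (d 0 2 * x ^ 2 ^ e) * h03
  · rw [h.lower_eq, listHom_apply]
    ext i j
    fin_cases i <;> fin_cases j <;>
      simp [list15, monoForm, famV, coe_lower, Matrix.mul_apply,
        Fin.sum_univ_four, r1, r2, d5]
    · linear_combination (d 0 3 * y ^ 2 ^ e) * hv
    · linear_combination (d 0 3 * y ^ 2 ^ e) * ho

lemma NormalForm.exists_matEquiv_zero_weight [CharP k 2] {e : ℕ}
    (h : NormalForm ρ (2 * 2 ^ e) 0 c d) (hr : ZeroWeightRelations c d) :
    ∃ i, MatEquiv ρ (listHom i) := by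
  by_cases hrow : c 0 1 = 0 ∧ c 0 2 = 0 <;> by_cases hcol : d 0 1 = 0 ∧ d 0 2 = 0
  · refine ⟨Idx15.XXIV (e + 1), matEquiv_standard (c := c) (d := d) (by rwa [pow_succ']) ?_ ?_
      hr.dual⟩
    · simp [hrow, hr.col_one, hr.col_two, hcol]
    · simp [hcol, hr.row_one, hr.row_two, hrow]
  · exact ⟨_, h.matEquiv_lower_extension hr hrow hcol⟩
  · exact ⟨_, h.matEquiv_upper_extension hr hrow hcol⟩
  · exact ⟨_, h.matEquiv_uniserial hr hrow hcol⟩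

end Cases

section Existence

lemma exists_ne_zero_one_add_ne_zero (k : Type*) [Field k] [Infinite k] :
    ∃ z : k, z ≠ 0 ∧ 1 + z ≠ 0 := by
  classical
  obtain ⟨z, hz⟩ := Infinite.exists_notMem_finset ({0, -1} : Finset k)
  simp only [Finset.mem_insert, Finset.mem_singleton, not_or] at hz
  exact ⟨z, hz.1, fun h0 => hz.2 (by linear_combination h0)⟩

variable {k : Type*} [Field k] [CharP k 2] [Infinite k] {ρ : (SL₂ k) →* M₄ k} {m n : ℕ}
  {c d : M₄ k}

lemma NormalForm.zeroWeightRelations {q : ℕ} (hq : 0 < q) (h : NormalForm ρ (2 * q) 0 c d) :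
    (∃ e, q = 2 ^ e) ∧ ZeroWeightRelations c d := by
  have c5 := h.upper_admissible.of_snd_eq_zero rfl
  have d5 := h.lower_admissible.of_snd_eq_zero rfl
  have eα : (2 * q - 0) / 2 = q := by omega
  have eβ : (2 * q + 0) / 2 = q := by omega
  obtain ⟨ho, hdual, a, ha⟩ := binomial_three_terms (A := c 0 1 * d 0 1 + c 0 2 * d 0 2)
    (C := c 0 3 * d 0 3) hq (show q < 2 * q by omega) (fun z hz => by
      rw [h.cross_zero_zero z hz, eα, eβ]
      ring)
  obtain ⟨e, rfl⟩ : ∃ e, a = e + 1 := Nat.exists_eq_succ_of_ne_zero (by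
    rintro rfl
    omega)
  have hqe : q = 2 ^ e := by rw [pow_succ'] at ha; omega
  obtain ⟨z, hz0, hz1⟩ := exists_ne_zero_one_add_ne_zero k
  have hzq : z ^ q ≠ 0 := pow_ne_zero _ hz0
  have hsq : (1 + z) ^ q ≠ 0 := pow_ne_zero _ hz1
  have hpow : (1 + z) ^ q = 1 + z ^ q := by rw [hqe, add_pow_char_pow, one_pow]
  have e1 : (1 + z) ^ (2 * q) * (1 / (1 + z)) ^ q = 1 + z ^ q := by
    rw [← hpow, two_mul, pow_add, div_pow, one_pow]
    field_simp
  have e2 : (z / (1 + z)) ^ q * (1 + z) ^ (2 * q) = z ^ q * (1 + z ^ q) := by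
    rw [← hpow, two_mul, pow_add, div_pow]
    field_simp
  have h01 := h.cross_zero_one z hz1
  have h02 := h.cross_zero_two z hz1
  have h10 := h.cross_one_zero z hz1
  have h20 := h.cross_two_zero z hz1
  rw [eα, eβ, e1, d5] at h01
  rw [eα, eβ, e1] at h02
  rw [eα, eβ, e2, c5] at h10
  rw [eβ, e2] at h20
  have f1 : c 0 3 * d 1 3 = c 0 1 := mul_right_cancel₀ hzq (by linear_combination h01)
  have f2 : c 0 3 * d 2 3 = c 0 2 := mul_right_cancel₀ hzq (by linear_combination h02)
  have f3 : c 1 3 * d 0 3 = d 0 1 := mul_right_cancel₀ (mul_ne_zero hzq hzq)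
    (by linear_combination h10)
  have f4 : c 2 3 * d 0 3 = d 0 2 := mul_right_cancel₀ (mul_ne_zero hzq hzq)
    (by linear_combination h20)
  refine ⟨⟨e, hqe⟩, hdual, ?_, ?_, ?_, ?_, ho⟩
  · linear_combination d 0 3 * f1 - d 1 3 * hdual
  · linear_combination d 0 3 * f2 - d 2 3 * hdual
  · linear_combination c 0 3 * f3 - c 1 3 * hdual
  · linear_combination c 0 3 * f4 - c 2 3 * hdual

lemma NormalForm.exists_matEquiv_of_snd_eq_zero (hm : 0 < m) (h : NormalForm ρ m 0 c d) :
    ∃ i, MatEquiv ρ (listHom i) := by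
  rcases Nat.even_or_odd' m with ⟨q, rfl | rfl⟩
  · obtain ⟨⟨e, rfl⟩, hr⟩ := h.zeroWeightRelations (by omega)
    exact h.exists_matEquiv_zero_weight hr
  · have hc := h.upper_admissible.parity (by omega)
    have hd := h.lower_admissible.parity (by omega)
    obtain ⟨h03, a, ha⟩ := binomial_two_terms (C := c 0 3 * d 0 3) hm (fun z hz => by
      rw [h.cross_zero_zero z hz, hc.1, hc.2.1]
      ring)
    rw [ha] at h
    exact ⟨_, h.matEquiv_standard hc hd h03⟩

lemma NormalForm.exists_matEquiv_of_eq (hm : 0 < m) (h : NormalForm ρ m m c d) :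
    ∃ i, MatEquiv ρ (listHom i) := by
  obtain ⟨c1, c2⟩ := h.upper_admissible.of_eq rfl
  obtain ⟨d1, d2⟩ := h.lower_admissible.of_eq rfl
  have eβ : (m + m) / 2 = m := by omega
  obtain ⟨h00, a, ha⟩ := binomial_two_terms (C := c 0 2 * d 0 2 + c 0 3 * d 0 3) hm
    (fun z hz => by
      rw [h.cross_zero_zero z hz, eβ, c1]
      ring)
  obtain ⟨h11, -⟩ := binomial_two_terms (C := c 1 2 * d 1 2 + c 1 3 * d 1 3) hm
    (fun z hz => by
      have := h.cross_one_one z hz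
      rw [eβ, c1] at this
      linear_combination this)
  obtain ⟨z, hz0, hz1⟩ := exists_ne_zero_one_add_ne_zero k
  have hzm : z ^ m ≠ 0 := pow_ne_zero _ hz0
  have h01 := h.cross_zero_one z hz1
  have h10 := h.cross_one_zero z hz1
  rw [eβ, c1] at h01
  rw [eβ, d1] at h10
  rw [ha] at h
  exact ⟨_, h.matEquiv_isotypic h00 (mul_right_cancel₀ hzm (by linear_combination h01))
    (mul_right_cancel₀ hzm (by linear_combination h10)) h11⟩

lemma NormalForm.exists_matEquiv_of_lt (hn : 0 < n) (hnm : n < m) (h : NormalForm ρ m n c d) :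
    ∃ i, MatEquiv ρ (listHom i) := by
  obtain ⟨h03, ⟨h01, -, a, rfl⟩ | ⟨h01, h02, b, a, hba, hα, hβ⟩⟩ := binomial_four_terms
    (show (m - n) / 2 < (m + n) / 2 by omega) (show (m + n) / 2 < m by omega) h.cross_zero_zero
  · have h11 : ∀ z : k, 1 + z ≠ 0 → (1 + z) ^ n =
        1 + c 1 2 * d 1 2 * z ^ n + c 1 3 * d 1 3 * z ^ ((2 ^ a + n) / 2) := fun z hz => by
      simpa [h01] using h.cross_one_one z hz
    have h13 : c 1 3 * d 1 3 = 0 := by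
      by_cases hpar : 2 ^ a % 2 = n % 2
      · have hj := coeff_identity (r := (1 : k)) (s := 1) (A := 0) (α := 0)
          (fun z hz => by simpa using h11 z hz) ((2 ^ a + n) / 2)
        rw [Nat.choose_eq_zero_of_lt (by omega), if_neg (by omega), if_neg (by omega),
          if_neg (by omega), if_pos rfl] at hj
        simpa using hj.symm
      · rw [(h.upper_admissible.parity hpar).2.2.1, zero_mul]
    obtain ⟨h12, b, rfl⟩ := binomial_two_terms hn (fun z hz => by simpa [h13] using h11 z hz)
    have hba : b < a := (Nat.pow_lt_pow_iff_right one_lt_two).mp hnm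
    exact ⟨_, h.matEquiv_direct_sum hba.le
      (h.upper_isAdditive.of_direct_sum hba h.upper_admissible (left_ne_zero_of_mul_eq_one h12))
      (h.lower_isAdditive.of_direct_sum hba h.lower_admissible (right_ne_zero_of_mul_eq_one h12))
      h03 h12⟩
  · have hpar : m % 2 = n % 2 := by
      by_contra hne
      exact left_ne_zero_of_mul_eq_one h01 (h.upper_admissible.parity hne).1
    obtain rfl : m = 2 ^ a + 2 ^ b := by omega
    obtain rfl : n = 2 ^ a - 2 ^ b := by omega
    exact ⟨_, h.matEquiv_tensor hba h01 h02 h03⟩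

lemma NormalForm.exists_matEquiv (h : NormalForm ρ m n c d) : ∃ i, MatEquiv ρ (listHom i) := by
  rcases Nat.eq_zero_or_pos n with rfl | hn
  · rcases Nat.eq_zero_or_pos m with rfl | hm
    · exact ⟨_, h.matEquiv_one⟩
    · exact h.exists_matEquiv_of_snd_eq_zero hm
  · rcases h.le.eq_or_lt with rfl | hlt
    · exact h.exists_matEquiv_of_eq hn
    · exact h.exists_matEquiv_of_lt hn hlt

end Existence

section Invariants

variable {k : Type*} [Field k]

/-- The highest weight of a member of the list. -/
def highWeight : Idx15 → ℤ
  | Idx15.IV b a _ => 2 ^ a + 2 ^ b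
  | Idx15.V e | Idx15.XI e | Idx15.XIX e => 2 ^ (e + 1)
  | Idx15.XV a _ _ => 2 ^ a
  | Idx15.XXIV e => 2 ^ e
  | Idx15.XXVI => 0

/-- The second nonnegative weight of a member of the list. -/
def lowWeight : Idx15 → ℤ
  | Idx15.IV b a _ => 2 ^ a - 2 ^ b
  | Idx15.XV _ b _ => 2 ^ b
  | Idx15.V _ | Idx15.XI _ | Idx15.XIX _ | Idx15.XXIV _ | Idx15.XXVI => 0

/-- The weights of the diagonal torus on a member of the list. -/
def weights (i : Idx15) : Fin 4 → ℤ :=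
  match i with
  | Idx15.IV _ _ _ => ![highWeight i, lowWeight i, -lowWeight i, -highWeight i]
  | Idx15.V _ => ![0, highWeight i, -highWeight i, 0]
  | _ => ![highWeight i, -highWeight i, lowWeight i, -lowWeight i]

lemma lowWeight_nonneg (i : Idx15) : 0 ≤ lowWeight i := by
  cases i with
  | IV b a h => exact sub_nonneg.mpr (pow_le_pow_right₀ one_le_two h.le)
  | XV a b h => exact pow_nonneg zero_le_two _
  | _ => exact le_rfl

lemma lowWeight_le_highWeight (i : Idx15) : lowWeight i ≤ highWeight i := by
  cases i with
  | IV b a h =>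
    have : (0 : ℤ) < 2 ^ b := by positivity
    simp only [lowWeight, highWeight]
    omega
  | XV a b h => exact pow_le_pow_right₀ one_le_two h
  | XXVI => exact le_rfl
  | _ => exact pow_nonneg zero_le_two _

lemma sum_weights_sq (i : Idx15) :
    ∑ j, weights i j ^ 2 = 2 * (highWeight i ^ 2 + lowWeight i ^ 2) := by
  cases i <;> simp only [weights, Fin.sum_univ_four, lowWeight] <;> simp <;> ring

lemma sum_weights_fourth (i : Idx15) :
    ∑ j, weights i j ^ 4 = 2 * (highWeight i ^ 4 + lowWeight i ^ 4) := by
  cases i <;> simp only [weights, Fin.sum_univ_four, lowWeight] <;> simp <;> ring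

lemma list15_torus (i : Idx15) (t : kˣ) :
    list15 2 i (torus t) = Matrix.diagonal fun j => ((t ^ weights i j : kˣ) : k) := by
  have hcast : ∀ e : ℕ, (t : k) ^ ((2 : ℤ) ^ e) = (t : k) ^ 2 ^ e := fun e => by
    rw [← zpow_natCast]; norm_cast
  have hcast' : ∀ e : ℕ, (t : k) ^ (2 * (2 : ℤ) ^ e) = (t : k) ^ (2 * 2 ^ e) := fun e => by
    rw [← zpow_natCast]; norm_cast
  ext r s
  cases i <;> fin_cases r <;> fin_cases s <;>
    simp [list15, kron4, blockDiag4, entryPow, famV, famXI, famXIX, weights, highWeight, lowWeight,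
      coe_torus, zpow_add₀ t.ne_zero, zpow_sub₀ t.ne_zero, hcast, hcast', pow_succ',
      div_eq_mul_inv, mul_comm]

lemma eq_of_sum_sq_of_sum_fourth {M N M' N' : ℤ} (hN : 0 ≤ N) (hM : N ≤ M) (hN' : 0 ≤ N')
    (hM' : N' ≤ M') (h2 : M ^ 2 + N ^ 2 = M' ^ 2 + N' ^ 2) (h4 : M ^ 4 + N ^ 4 = M' ^ 4 + N' ^ 4) :
    M = M' ∧ N = N' := by
  have hdiff : M ^ 2 - N ^ 2 = M' ^ 2 - N' ^ 2 := by
    refine (sq_eq_sq₀ (by nlinarith) (by nlinarith)).mp ?_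
    linear_combination 2 * h4 - (M ^ 2 + N ^ 2 + M' ^ 2 + N' ^ 2) * h2
  exact ⟨(sq_eq_sq₀ (hN.trans hM) (hN'.trans hM')).mp (by linarith),
    (sq_eq_sq₀ hN hN').mp (by linarith)⟩

lemma MatEquiv.exists_intertwiner {f g : (SL₂ k) → M₄ k} (h : MatEquiv f g) :
    ∃ P : M₄ k, P.det ≠ 0 ∧ ∀ A, f A * P = P * g A := by
  obtain ⟨P, hP⟩ := h
  refine ⟨P, ((Matrix.isUnit_iff_isUnit_det _).mp P.isUnit).ne_zero, fun A => ?_⟩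
  rw [← hP A, ← mul_assoc, Units.mul_inv_cancel_left]

lemma weights_eq_of_matEquiv [Infinite k] {i j : Idx15}
    (h : MatEquiv (list15 (k := k) 2 i) (list15 2 j)) :
    highWeight i = highWeight j ∧ lowWeight i = lowWeight j := by
  obtain ⟨P, hdet, hP⟩ := MatEquiv.exists_intertwiner h
  obtain ⟨π, hπ⟩ := exists_perm_weights (w := weights i) (w' := weights j) hdet (fun t => by
    rw [← list15_torus, ← list15_torus, hP])
  have hsum : ∀ r : ℕ, ∑ l, weights i l ^ r = ∑ l, weights j l ^ r := fun r => by
    rw [← Equiv.sum_comp π]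
    simp only [hπ]
  have h2 := hsum 2
  have h4 := hsum 4
  rw [sum_weights_sq, sum_weights_sq] at h2
  rw [sum_weights_fourth, sum_weights_fourth] at h4
  exact eq_of_sum_sq_of_sum_fourth (lowWeight_nonneg i) (lowWeight_le_highWeight i)
    (lowWeight_nonneg j) (lowWeight_le_highWeight j) (by linarith) (by linarith)

/-- The map has two linearly independent fixed vectors. -/
def HasFixedPlane (f : (SL₂ k) → M₄ k) : Prop :=
  ∃ v w : Fin 4 → k, LinearIndependent k ![v, w] ∧ ∀ A, f A *ᵥ v = v ∧ f A *ᵥ w = w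

lemma MatEquiv.hasFixedPlane {f g : (SL₂ k) → M₄ k} (h : MatEquiv f g) (hf : HasFixedPlane f) :
    HasFixedPlane g := by
  obtain ⟨P, hP⟩ := h
  obtain ⟨v, w, hvw, hfix⟩ := hf
  have hmove : ∀ u, (∀ A, f A *ᵥ u = u) →
      ∀ A, g A *ᵥ ((P⁻¹ : GL (Fin 4) k) : M₄ k) *ᵥ u = ((P⁻¹ : GL (Fin 4) k) : M₄ k) *ᵥ u := by
    intro u hu A
    rw [← hP A, Matrix.mulVec_mulVec, mul_assoc, mul_assoc, Units.mul_inv, mul_one,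
      ← Matrix.mulVec_mulVec, hu]
  refine ⟨_, _, ?_, fun A => ⟨hmove v (fun A => (hfix A).1) A, hmove w (fun A => (hfix A).2) A⟩⟩
  rw [LinearIndependent.pair_iff] at hvw ⊢
  intro s t hst
  refine hvw s t ?_
  have := congrArg (fun u => (P : M₄ k) *ᵥ u) hst
  simpa [Matrix.mulVec_add, Matrix.mulVec_smul, Matrix.mulVec_mulVec] using this

lemma MatEquiv.transpose {f g : (SL₂ k) → M₄ k} (h : MatEquiv f g) :
    MatEquiv (fun A => (f A)ᵀ) (fun A => (g A)ᵀ) := by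
  obtain ⟨P, hP⟩ := h
  refine ⟨⟨((P⁻¹ : GL (Fin 4) k) : M₄ k)ᵀ, (P : M₄ k)ᵀ, ?_, ?_⟩, fun A => ?_⟩
  · rw [← Matrix.transpose_mul, Units.mul_inv, Matrix.transpose_one]
  · rw [← Matrix.transpose_mul, Units.inv_mul, Matrix.transpose_one]
  · change (P : M₄ k)ᵀ * (f A)ᵀ * ((P⁻¹ : GL (Fin 4) k) : M₄ k)ᵀ = (g A)ᵀ
    rw [← hP A, Matrix.transpose_mul, Matrix.transpose_mul, mul_assoc]

lemma not_hasFixedPlane {f : (SL₂ k) → M₄ k} (j : Fin 4)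
    (h : ∀ v, (∀ A, f A *ᵥ v = v) → ∀ i, i ≠ j → v i = 0) : ¬ HasFixedPlane f := by
  rintro ⟨v, w, hvw, hfix⟩
  have hv := h v fun A => (hfix A).1
  have hw := h w fun A => (hfix A).2
  rw [LinearIndependent.pair_iff] at hvw
  have h1 := hvw (w j) (-v j) (by
    ext i
    by_cases hi : i = j
    · subst hi
      simp [mul_comm]
    · simp [hv i hi, hw i hi])
  have h2 := hvw 1 0 (by
    ext i
    by_cases hi : i = j
    · subst hi
      simpa using h1.2
    · simp [hv i hi])
  exact one_ne_zero h2.1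

lemma hasFixedPlane_of_single {f : (SL₂ k) → M₄ k}
    (h2 : ∀ A, f A *ᵥ Pi.single 2 1 = Pi.single 2 1)
    (h3 : ∀ A, f A *ᵥ Pi.single 3 1 = Pi.single 3 1) : HasFixedPlane f := by
  refine ⟨_, _, ?_, fun A => ⟨h2 A, h3 A⟩⟩
  rw [LinearIndependent.pair_iff]
  intro s t hst
  constructor
  · simpa using congrFun hst 2
  · simpa using congrFun hst 3

lemma hasFixedPlane_XIX (e : ℕ) : HasFixedPlane (list15 (k := k) 2 (Idx15.XIX e)) := by
  refine hasFixedPlane_of_single (fun A => ?_) (fun A => ?_) <;> ext i <;> fin_cases i <;>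
    simp [list15, famXIX]

lemma hasFixedPlane_XXIV (e : ℕ) : HasFixedPlane (list15 (k := k) 2 (Idx15.XXIV e)) := by
  refine hasFixedPlane_of_single (fun A => ?_) (fun A => ?_) <;> ext i <;> fin_cases i <;>
    simp [list15, blockDiag4]

lemma hasFixedPlane_transpose_XI (e : ℕ) :
    HasFixedPlane (fun A => (list15 (k := k) 2 (Idx15.XI e) A)ᵀ) := by
  refine hasFixedPlane_of_single (fun A => ?_) (fun A => ?_) <;> ext i <;> fin_cases i <;>
    simp [list15, famXI]

lemma hasFixedPlane_transpose_XXIV (e : ℕ) :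
    HasFixedPlane (fun A => (list15 (k := k) 2 (Idx15.XXIV e) A)ᵀ) := by
  refine hasFixedPlane_of_single (fun A => ?_) (fun A => ?_) <;> ext i <;> fin_cases i <;>
    simp [list15, blockDiag4]

lemma eq_zero_of_torus_fixed [Infinite k] {w : ℤ} (hw : w ≠ 0) {x : k}
    (h : ∀ t : kˣ, ((t ^ w : kˣ) : k) * x = x) : x = 0 := by
  obtain ⟨t, ht⟩ := exists_zpow_ne_one (k := k) hw
  by_contra hx
  exact ht (Units.ext (mul_right_cancel₀ hx (by simpa using h t)))

lemma fixed_apply_eq_zero [Infinite k] {i : Idx15} {v : Fin 4 → k}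
    (hv : ∀ t : kˣ, list15 2 i (torus t) *ᵥ v = v) {j : Fin 4} (hj : weights i j ≠ 0) :
    v j = 0 :=
  eq_zero_of_torus_fixed hj fun t => by
    simpa [list15_torus, Matrix.mulVec_diagonal] using congrFun (hv t) j

lemma fixed_transpose_apply_eq_zero [Infinite k] {i : Idx15} {v : Fin 4 → k}
    (hv : ∀ t : kˣ, (list15 2 i (torus t))ᵀ *ᵥ v = v) {j : Fin 4} (hj : weights i j ≠ 0) :
    v j = 0 :=
  fixed_apply_eq_zero (fun t => by
    have := hv t
    rwa [list15_torus, Matrix.diagonal_transpose, ← list15_torus] at this) hj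

lemma not_hasFixedPlane_V [Infinite k] (e : ℕ) :
    ¬ HasFixedPlane (list15 (k := k) 2 (Idx15.V e)) := by
  refine not_hasFixedPlane 3 fun v hv => ?_
  have h1 : v 1 = 0 := fixed_apply_eq_zero (fun t => hv (torus t)) (by simp [weights, highWeight])
  have h2 : v 2 = 0 := fixed_apply_eq_zero (fun t => hv (torus t)) (by simp [weights, highWeight])
  have h0 := congrFun (hv (upper 1)) 1
  simp [list15, famV, coe_upper, Matrix.mulVec, dotProduct, Fin.sum_univ_four, h1, h2] at h0
  intro i hi
  fin_cases i <;> simp_all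

lemma not_hasFixedPlane_XI [Infinite k] (e : ℕ) :
    ¬ HasFixedPlane (list15 (k := k) 2 (Idx15.XI e)) := by
  refine not_hasFixedPlane 3 fun v hv => ?_
  have h0 : v 0 = 0 := fixed_apply_eq_zero (fun t => hv (torus t)) (by simp [weights, highWeight])
  have h1 : v 1 = 0 := fixed_apply_eq_zero (fun t => hv (torus t)) (by simp [weights, highWeight])
  have h2 := congrFun (hv (upper 1)) 0
  simp [list15, famXI, coe_upper, Matrix.mulVec, dotProduct, Fin.sum_univ_four, h0, h1] at h2
  intro i hi
  fin_cases i <;> simp_all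

lemma not_hasFixedPlane_transpose_V [Infinite k] (e : ℕ) :
    ¬ HasFixedPlane (fun A => (list15 (k := k) 2 (Idx15.V e) A)ᵀ) := by
  refine not_hasFixedPlane 0 fun v hv => ?_
  have h1 : v 1 = 0 := fixed_transpose_apply_eq_zero (fun t => hv (torus t))
    (by simp [weights, highWeight])
  have h2 : v 2 = 0 := fixed_transpose_apply_eq_zero (fun t => hv (torus t))
    (by simp [weights, highWeight])
  have h3 := congrFun (hv (upper 1)) 2
  simp [list15, famV, coe_upper, Matrix.mulVec, dotProduct, Fin.sum_univ_four, h1, h2] at h3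
  intro i hi
  fin_cases i <;> simp_all

lemma not_hasFixedPlane_transpose_XIX [Infinite k] (e : ℕ) :
    ¬ HasFixedPlane (fun A => (list15 (k := k) 2 (Idx15.XIX e) A)ᵀ) := by
  refine not_hasFixedPlane 3 fun v hv => ?_
  have h0 : v 0 = 0 := fixed_transpose_apply_eq_zero (fun t => hv (torus t))
    (by simp [weights, highWeight])
  have h1 : v 1 = 0 := fixed_transpose_apply_eq_zero (fun t => hv (torus t))
    (by simp [weights, highWeight])
  have h2 := congrFun (hv (upper 1)) 1
  simp [list15, famXIX, coe_upper, Matrix.mulVec, dotProduct, Fin.sum_univ_four, h0, h1] at h2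
  intro i hi
  fin_cases i <;> simp_all

lemma two_pow_int_injective {a b : ℕ} (h : (2 : ℤ) ^ a = 2 ^ b) : a = b :=
  Nat.pow_right_injective le_rfl (by exact_mod_cast h)

lemma two_pow_add_two_pow_ne {a b c : ℕ} (hba : b < a) : (2 : ℤ) ^ a + 2 ^ b ≠ 2 ^ c := by
  intro h
  have hb : (0 : ℤ) < 2 ^ b := by positivity
  have hlt : (2 : ℤ) ^ b < 2 ^ a := pow_lt_pow_right₀ one_lt_two hba
  have h1 : a < c := (pow_lt_pow_iff_right₀ (one_lt_two (α := ℤ))).mp (by omega)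
  have h2 : c < a + 1 := (pow_lt_pow_iff_right₀ (one_lt_two (α := ℤ))).mp (by rw [pow_succ]; omega)
  omega

/-- Distinct members of the list are inequivalent. -/
lemma eq_of_matEquiv_list15 [Infinite k] {i j : Idx15}
    (h : MatEquiv (list15 (k := k) 2 i) (list15 2 j)) : i = j := by
  have hfix := fun hi => MatEquiv.hasFixedPlane h hi
  have hfix' := fun hj => MatEquiv.hasFixedPlane (MatEquiv.symm h) hj
  have hfixT := fun hi => MatEquiv.hasFixedPlane (MatEquiv.transpose h) hi
  have hfixT' := fun hj => MatEquiv.hasFixedPlane (MatEquiv.transpose (MatEquiv.symm h)) hj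
  obtain ⟨hM, hN⟩ := weights_eq_of_matEquiv h
  have hpos : ∀ e : ℕ, (2 : ℤ) ^ e ≠ 0 := fun e => by positivity
  have hsub : ∀ {a b : ℕ}, b < a → (2 : ℤ) ^ a - 2 ^ b ≠ 0 := fun hba =>
    sub_ne_zero.mpr (pow_lt_pow_right₀ one_lt_two hba).ne'
  cases i with
  | IV b a hba =>
    cases j with
    | IV b' a' hba' =>
      simp only [highWeight, lowWeight] at hM hN
      obtain rfl := two_pow_int_injective (show (2 : ℤ) ^ a = 2 ^ a' by omega)
      obtain rfl := two_pow_int_injective (show (2 : ℤ) ^ b = 2 ^ b' by omega)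
      rfl
    | XV => exact absurd hM (two_pow_add_two_pow_ne hba)
    | _ => exact absurd hN (hsub hba)
  | XV a b hba =>
    cases j with
    | IV b' a' hba' => exact absurd hM.symm (two_pow_add_two_pow_ne hba')
    | XV a' b' hba' =>
      obtain rfl := two_pow_int_injective hM
      obtain rfl := two_pow_int_injective hN
      rfl
    | _ => exact absurd hN (hpos _)
  | XXVI =>
    cases j with
    | IV b a hba => exact absurd hN.symm (hsub hba)
    | XXVI => rfl
    | _ => exact absurd hM.symm (hpos _)
  | V e =>
    cases j with
    | IV b a hba => exact absurd hN.symm (hsub hba)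
    | XV => exact absurd hN.symm (hpos _)
    | XXVI => exact absurd hM (hpos _)
    | V e' =>
      obtain rfl : e = e' := Nat.succ_injective (two_pow_int_injective hM)
      rfl
    | XI e' => exact absurd (hfixT' (hasFixedPlane_transpose_XI e')) (not_hasFixedPlane_transpose_V e)
    | XIX e' => exact absurd (hfix' (hasFixedPlane_XIX e')) (not_hasFixedPlane_V e)
    | XXIV e' => exact absurd (hfix' (hasFixedPlane_XXIV e')) (not_hasFixedPlane_V e)
  | XI e =>
    cases j with
    | IV b a hba => exact absurd hN.symm (hsub hba)
    | XV => exact absurd hN.symm (hpos _)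
    | XXVI => exact absurd hM (hpos _)
    | V e' => exact absurd (hfixT (hasFixedPlane_transpose_XI e)) (not_hasFixedPlane_transpose_V e')
    | XI e' =>
      obtain rfl : e = e' := Nat.succ_injective (two_pow_int_injective hM)
      rfl
    | XIX e' => exact absurd (hfix' (hasFixedPlane_XIX e')) (not_hasFixedPlane_XI e)
    | XXIV e' => exact absurd (hfix' (hasFixedPlane_XXIV e')) (not_hasFixedPlane_XI e)
  | XIX e =>
    cases j with
    | IV b a hba => exact absurd hN.symm (hsub hba)
    | XV => exact absurd hN.symm (hpos _)
    | XXVI => exact absurd hM (hpos _)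
    | V e' => exact absurd (hfix (hasFixedPlane_XIX e)) (not_hasFixedPlane_V e')
    | XI e' => exact absurd (hfix (hasFixedPlane_XIX e)) (not_hasFixedPlane_XI e')
    | XIX e' =>
      obtain rfl : e = e' := Nat.succ_injective (two_pow_int_injective hM)
      rfl
    | XXIV e' =>
      exact absurd (hfixT' (hasFixedPlane_transpose_XXIV e')) (not_hasFixedPlane_transpose_XIX e)
  | XXIV e =>
    cases j with
    | IV b a hba => exact absurd hN.symm (hsub hba)
    | XV => exact absurd hN.symm (hpos _)
    | XXVI => exact absurd hM (hpos _)
    | V e' => exact absurd (hfix (hasFixedPlane_XXIV e)) (not_hasFixedPlane_V e')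
    | XI e' => exact absurd (hfix (hasFixedPlane_XXIV e)) (not_hasFixedPlane_XI e')
    | XIX e' =>
      exact absurd (hfixT (hasFixedPlane_transpose_XXIV e)) (not_hasFixedPlane_transpose_XIX e')
    | XXIV e' =>
      obtain rfl := two_pow_int_injective hM
      rfl

/-- Every rational representation is equivalent to a member of the list. -/
lemma exists_matEquiv_list15 [CharP k 2] [IsAlgClosed k] (f : (SL₂ k) →* M₄ k)
    (hf : IsPolyEntries f) : ∃ i, MatEquiv f (list15 2 i) := by
  have : Infinite k := IsAlgClosed.instInfinite
  obtain ⟨ρ, m, n, c, d, hfρ, h⟩ := exists_normalForm f hf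
  obtain ⟨i, hi⟩ := h.exists_matEquiv
  exact ⟨i, MatEquiv.trans hfρ hi⟩

end Invariants

end SL2CharTwo

/-- For `p = 2`, every homomorphism of algebraic groups
`σ : SL(2,k) → SL(4,k)` is equivalent to exactly one member of the list (IV), (V), (XI),
(XV), (XIX), (XXIV), (XXVI); in particular distinct members of the list are
inequivalent. -/
theorem stmt15 {k : Type*} [Field k] [IsAlgClosed k] {p : ℕ} [Fact p.Prime] [CharP k p]
    (hp : p = 2) :
    (∀ σ : SpecialLinearGroup (Fin 2) k →* SpecialLinearGroup (Fin 4) k,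
        IsPolyEntries (fun A => (σ A).1) →
          ∃! i : Idx15, MatEquiv (fun A => (σ A).1) (list15 p i)) ∧
      ∀ i j : Idx15, MatEquiv (list15 (k := k) p i) (list15 (k := k) p j) → i = j := by
  subst hp
  have : Infinite k := IsAlgClosed.instInfinite
  refine ⟨fun σ hσ => ?_, fun i j h => SL2CharTwo.eq_of_matEquiv_list15 h⟩
  obtain ⟨i, hi⟩ := SL2CharTwo.exists_matEquiv_list15
    ⟨⟨fun A => (σ A).1, by simp⟩, fun A B => by simp⟩ hσ
  exact ⟨i, hi, fun j hj =>
    SL2CharTwo.eq_of_matEquiv_list15 (SL2CharTwo.MatEquiv.trans (SL2CharTwo.MatEquiv.symm hj) hi)⟩
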